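/- arXiv:2409.06200 — 2 statements merged into one kernel-verified Lean document; each statement's English description precedes it below -/
import Mathlib

section
/- Let G be an infinite finitely generated nilpotent group and let A be a nontrivial residually finite abelian group. Then A ≀ G is hereditarily conjugacy separable, but for every prime p the group A ≀ G is not p-conjugacy separable. -/
open Pointwise

universe u

structure ECPseudoVariety : Type (u + 1) where
  mem : ∀ (G : Type u) [Group G], Prop
  finite : ∀ (G : Type u) [Group G], mem G → Finite G
  iso_closed : ∀ (G H : Type u) [Group G] [Group H], G ≃* H → mem G → mem H
  subgroup_closed : ∀ (G : Type u) [Group G] (H : Subgroup G), mem G → mem ↥H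
  quotient_closed : ∀ (G : Type u) [Group G] (N : Subgroup G) [N.Normal],
    mem G → mem (G ⧸ N)
  prod_closed : ∀ (G H : Type u) [Group G] [Group H], mem G → mem H → mem (G × H)
  extension_closed : ∀ (G : Type u) [Group G] (N : Subgroup G) [N.Normal],
    mem ↥N → mem (G ⧸ N) → mem G

namespace ECPseudoVariety

variable (V : ECPseudoVariety.{u})

def coC (G : Type u) [Group G] : Set (Subgroup G) :=
  {N | ∃ hN : N.Normal, haveI := hN; V.mem (G ⧸ N)}

def CSeparable {G : Type u} [Group G] (X : Set G) : Prop :=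
  ∀ g : G, g ∉ X → ∃ N ∈ V.coC G, (QuotientGroup.mk g : G ⧸ N) ∉ QuotientGroup.mk '' X

def Residually (G : Type u) [Group G] : Prop :=
  ∀ g : G, g ≠ 1 → ∃ N ∈ V.coC G, g ∉ N

def ConjSep (G : Type u) [Group G] : Prop :=
  ∀ g : G, V.CSeparable {x : G | IsConj g x}

def COpen {G : Type u} [Group G] (H : Subgroup G) : Prop :=
  ∃ N ∈ V.coC G, N ≤ H

def HCS (G : Type u) [Group G] : Prop :=
  V.ConjSep G ∧ ∀ H : Subgroup G, V.COpen H → V.ConjSep ↥H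

def CyclicSep (G : Type u) [Group G] : Prop :=
  ∀ g : G, V.CSeparable ((Subgroup.zpowers g : Subgroup G) : Set G)

end ECPseudoVariety

def CCWitness {G : Type u} [Group G] (g : G) (K L : Subgroup G) [L.Normal] : Prop :=
  (Subgroup.centralizer {(QuotientGroup.mk g : G ⧸ L)} : Set (G ⧸ L)) ⊆
    QuotientGroup.mk '' ((Subgroup.centralizer {g} : Set G) * (K : Set G))

namespace ECPseudoVariety

variable (V : ECPseudoVariety.{u})

def SatisfiesCCAt {G : Type u} [Group G] (g : G) : Prop :=
  ∀ K ∈ V.coC G, ∃ L ∈ V.coC G, L ≤ K ∧ ∃ hL : L.Normal, haveI := hL; CCWitness g K L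

def SatisfiesCC (G : Type u) [Group G] : Prop :=
  ∀ g : G, V.SatisfiesCCAt g

end ECPseudoVariety

/-- `G` is conjugacy separable. -/
def IsConjSeparable (G : Type u) [Group G] : Prop :=
  ∀ x y : G, ¬ IsConj x y → ∃ N : Subgroup G, ∃ hN : N.Normal, N.FiniteIndex ∧
    (haveI := hN; ¬ IsConj (QuotientGroup.mk x : G ⧸ N) (QuotientGroup.mk y))

/-- `G` is hereditarily conjugacy separable: every finite-index subgroup is
conjugacy separable. -/
def IsHereditarilyConjSeparable (G : Type u) [Group G] : Prop :=
  ∀ H : Subgroup G, H.FiniteIndex → IsConjSeparable H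

/-- `G` is residually finite. -/
def IsResiduallyFinite (G : Type u) [Group G] : Prop :=
  ∀ g : G, g ≠ 1 → ∃ N : Subgroup G, N.Normal ∧ N.FiniteIndex ∧ g ∉ N

/-- Normal subgroups with finite `p`-group quotient. -/
def pCoC (p : ℕ) (G : Type u) [Group G] : Set (Subgroup G) :=
  {N | ∃ hN : N.Normal, Finite (G ⧸ N) ∧ (haveI := hN; IsPGroup p (G ⧸ N))}

/-- `G` is `p`-conjugacy separable. -/
def pConjSep (p : ℕ) (G : Type u) [Group G] : Prop :=
  ∀ x y : G, ¬ IsConj x y → ∃ N ∈ pCoC p G, ∃ hN : N.Normal,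
    haveI := hN; ¬ IsConj (QuotientGroup.mk x : G ⧸ N) (QuotientGroup.mk y)

/-- A subgroup is `p`-open if it contains a normal subgroup with finite
`p`-group quotient. -/
def pOpen (p : ℕ) {G : Type u} [Group G] (H : Subgroup G) : Prop :=
  ∃ N ∈ pCoC p G, N ≤ H

/-- `G` is `p`-hereditarily conjugacy separable. -/
def pHCS (p : ℕ) (G : Type u) [Group G] : Prop :=
  pConjSep p G ∧ ∀ H : Subgroup G, pOpen p H → pConjSep p H

/-- The base group of the restricted wreath product: finitely supported functions `B → A`. -/
def WreathBase (A B : Type u) [Group A] : Subgroup (B → A) where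
  carrier := {f | (Function.mulSupport f).Finite}
  one_mem' := by simp
  mul_mem' := fun hf hg =>
    Set.Finite.subset (Set.Finite.union hf hg) (Function.mulSupport_mul _ _)
  inv_mem' := fun hf => Set.Finite.subset hf fun x hx => by
    simp only [Function.mem_mulSupport] at hx ⊢
    simpa using hx

/-- Shift automorphism of the base group: `(c • f) x = f (c⁻¹ * x)`. -/
def wreathShift (A B : Type u) [Group A] [Group B] (c : B) :
    WreathBase A B ≃* WreathBase A B where
  toFun f := ⟨fun x => (f : B → A) (c⁻¹ * x), by
    have hsub : (Function.mulSupport fun x => (f : B → A) (c⁻¹ * x)) ⊆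
        (fun x : B => c * x) '' Function.mulSupport (f : B → A) := by
      intro x hx
      exact ⟨c⁻¹ * x, hx, by simp⟩
    exact (f.2.image _).subset hsub⟩
  invFun f := ⟨fun x => (f : B → A) (c * x), by
    have hsub : (Function.mulSupport fun x => (f : B → A) (c * x)) ⊆
        (fun x : B => c⁻¹ * x) '' Function.mulSupport (f : B → A) := by
      intro x hx
      exact ⟨c * x, hx, by simp⟩
    exact (f.2.image _).subset hsub⟩
  left_inv f := Subtype.ext (funext fun x => by simp)
  right_inv f := Subtype.ext (funext fun x => by simp)
  map_mul' f g := rfl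

/-- The action of `B` on the base group of the wreath product. -/
def wreathAction (A B : Type u) [Group A] [Group B] : B →* MulAut (WreathBase A B) where
  toFun := wreathShift A B
  map_one' := by
    apply MulEquiv.ext
    intro f
    apply Subtype.ext
    funext x
    show (f : B → A) ((1 : B)⁻¹ * x) = (f : B → A) x
    simp
  map_mul' c d := by
    apply MulEquiv.ext
    intro f
    apply Subtype.ext
    funext x
    show (f : B → A) ((c * d)⁻¹ * x) = (f : B → A) (d⁻¹ * (c⁻¹ * x))
    rw [mul_inv_rev, mul_assoc]

/-- The restricted wreath product `A ≀ B`. -/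
abbrev RWreath (A B : Type u) [Group A] [Group B] : Type u :=
  SemidirectProduct (WreathBase A B) B (wreathAction A B)
def rcoset {B : Type u} [Group B] (b x : B) : Set B :=
  {y : B | y * x⁻¹ ∈ Subgroup.zpowers b}

lemma rcoset_mul_left {B : Type u} [Group B] {b c : B}
    (hc : c ∈ Subgroup.centralizer {b}) (y : B) :
    rcoset b (c * y) = (c * ·) '' rcoset b y := by
  have hcomm : b * c = c * b := Subgroup.mem_centralizer_iff.mp hc b rfl
  have hC : Commute b c := hcomm
  ext z
  simp only [rcoset, Set.mem_setOf_eq, Set.mem_image]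
  constructor
  · intro hz
    refine ⟨c⁻¹ * z, ?_, by group⟩
    obtain ⟨k, hk⟩ := Subgroup.mem_zpowers_iff.mp hz
    refine Subgroup.mem_zpowers_iff.mpr ⟨k, ?_⟩
    have hcc : b ^ k * c = c * b ^ k := (hC.zpow_left k).eq
    have hk' : z * y⁻¹ = b ^ k * c := by
      rw [hk]; group
    calc b ^ k = c⁻¹ * (c * b ^ k) := by group
      _ = c⁻¹ * (b ^ k * c) := by rw [hcc]
      _ = c⁻¹ * (z * y⁻¹) := by rw [hk']
      _ = c⁻¹ * z * y⁻¹ := by group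
  · rintro ⟨w, hw, rfl⟩
    obtain ⟨k, hk⟩ := Subgroup.mem_zpowers_iff.mp hw
    refine Subgroup.mem_zpowers_iff.mpr ⟨k, ?_⟩
    have hcc : b ^ k * c = c * b ^ k := (hC.zpow_left k).eq
    calc b ^ k = c * b ^ k * c⁻¹ := by rw [← hcc]; group
      _ = c * (w * y⁻¹) * c⁻¹ := by rw [hk]
      _ = c * w * (c * y)⁻¹ := by group

/-- An element `fb` of `A ≀ B` is reduced if distinct elements of `supp f` lie in
distinct right cosets of `⟨b⟩`. -/
def IsReducedPair {A B : Type u} [Group A] [Group B] (f : WreathBase A B) (b : B) : Prop :=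
  ∀ s ∈ Function.mulSupport (f : B → A), ∀ t ∈ Function.mulSupport (f : B → A),
    t * s⁻¹ ∈ Subgroup.zpowers b → s = t

/-- The set `C_B(f,b) = C⁺_B(f,b) ∩ C_B(b)`. -/
def CBset {A B : Type u} [Group A] [Group B] (f : WreathBase A B) (b : B) : Set B :=
  {c | c ∈ Subgroup.centralizer {b} ∧
    ∀ a : A, a ≠ 1 → a ∈ Set.range (f : B → A) →
      (fun s : B => rcoset b (c * s)) '' ((f : B → A) ⁻¹' {a}) =
        rcoset b '' ((f : B → A) ⁻¹' {a})}

/-- `C_B(f,b)` as a subgroup of `B`. -/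
def CBsubgroup {A B : Type u} [Group A] [Group B] (f : WreathBase A B) (b : B) :
    Subgroup B where
  carrier := CBset f b
  one_mem' := by
    refine ⟨Subgroup.one_mem _, ?_⟩
    intro a _ _
    simp
  mul_mem' := by
    rintro c c' ⟨hc1, hc2⟩ ⟨hc'1, hc'2⟩
    refine ⟨Subgroup.mul_mem _ hc1 hc'1, ?_⟩
    intro a ha har
    calc (fun s : B => rcoset b (c * c' * s)) '' ((f : B → A) ⁻¹' {a})
        = (fun s : B => (c * ·) '' rcoset b (c' * s)) '' ((f : B → A) ⁻¹' {a}) := by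
          have he : (fun s : B => rcoset b (c * c' * s)) =
              fun s : B => (c * ·) '' rcoset b (c' * s) := by
            funext s; rw [mul_assoc, rcoset_mul_left hc1]
          rw [he]
      _ = (fun X : Set B => (c * ·) '' X) ''
            ((fun s : B => rcoset b (c' * s)) '' ((f : B → A) ⁻¹' {a})) := by
          rw [Set.image_image]
      _ = (fun X : Set B => (c * ·) '' X) '' (rcoset b '' ((f : B → A) ⁻¹' {a})) := by
          rw [hc'2 a ha har]
      _ = (fun s : B => (c * ·) '' rcoset b s) '' ((f : B → A) ⁻¹' {a}) := by
          rw [Set.image_image]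
      _ = (fun s : B => rcoset b (c * s)) '' ((f : B → A) ⁻¹' {a}) := by
          have he : (fun s : B => (c * ·) '' rcoset b s) =
              fun s : B => rcoset b (c * s) := by
            funext s; rw [rcoset_mul_left hc1]
          rw [he]
      _ = rcoset b '' ((f : B → A) ⁻¹' {a}) := hc2 a ha har
  inv_mem' := by
    rintro c ⟨hc1, hc2⟩
    have hinv : c⁻¹ ∈ Subgroup.centralizer {b} := Subgroup.inv_mem _ hc1
    refine ⟨hinv, ?_⟩
    intro a ha har
    calc (fun s : B => rcoset b (c⁻¹ * s)) '' ((f : B → A) ⁻¹' {a})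
        = (fun s : B => (c⁻¹ * ·) '' rcoset b s) '' ((f : B → A) ⁻¹' {a}) := by
          have he : (fun s : B => rcoset b (c⁻¹ * s)) =
              fun s : B => (c⁻¹ * ·) '' rcoset b s := by
            funext s; rw [rcoset_mul_left hinv]
          rw [he]
      _ = (fun X : Set B => (c⁻¹ * ·) '' X) '' (rcoset b '' ((f : B → A) ⁻¹' {a})) := by
          rw [Set.image_image]
      _ = (fun X : Set B => (c⁻¹ * ·) '' X) ''
            ((fun s : B => rcoset b (c * s)) '' ((f : B → A) ⁻¹' {a})) := by
          rw [hc2 a ha har]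
      _ = (fun s : B => (c⁻¹ * ·) '' rcoset b (c * s)) '' ((f : B → A) ⁻¹' {a}) := by
          rw [Set.image_image]
      _ = rcoset b '' ((f : B → A) ⁻¹' {a}) := by
          have he : (fun s : B => (c⁻¹ * ·) '' rcoset b (c * s)) =
              fun s : B => rcoset b s := by
            funext s; rw [← rcoset_mul_left hinv, inv_mul_cancel_left]
          rw [he]

/-- The permutation group condition set `Σ(f,b)`. -/
def SigmaSet {A B : Type u} [Group A] [Group B] (f : WreathBase A B) (b : B) :
    Set (Equiv.Perm ↥(Function.mulSupport (f : B → A))) :=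
  {σ | ∀ a : A, a ≠ 1 →
    (fun s : ↥(Function.mulSupport (f : B → A)) => rcoset b ↑(σ s)) ''
        {s : ↥(Function.mulSupport (f : B → A)) | (f : B → A) ↑s = a} =
      (fun s : ↥(Function.mulSupport (f : B → A)) => rcoset b ↑s) ''
        {s : ↥(Function.mulSupport (f : B → A)) | (f : B → A) ↑s = a}}
namespace WNil
set_option linter.style.haveILetI false
open scoped commutatorElement

lemma exists_lift_fg {G : Type*} [Group G] (N : Subgroup G) [N.Normal] (H : Subgroup G)
    (h : (H.map (QuotientGroup.mk' N)).FG) :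
    ∃ X : Set G, X.Finite ∧ X ⊆ H ∧ H ≤ Subgroup.closure X ⊔ N := by
  classical
  obtain ⟨S, hS, hfin⟩ := (Subgroup.fg_iff _).1 h
  have hsub : S ⊆ (QuotientGroup.mk' N) '' (H : Set G) := by
    intro s hs
    have : s ∈ H.map (QuotientGroup.mk' N) := by rw [← hS]; exact Subgroup.subset_closure hs
    exact this
  obtain ⟨X, hXH, hX, hXS⟩ : ∃ X : Set G, X ⊆ H ∧ X.Finite ∧ QuotientGroup.mk' N '' X = S := by
    obtain ⟨X, hX, hX2⟩ := Set.exists_subset_bijOn (H : Set G) (QuotientGroup.mk' N) 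
    refine ⟨X ∩ (QuotientGroup.mk' N) ⁻¹' S, fun x hx => hX hx.1, ?_, ?_⟩
    · refine Set.Finite.of_finite_image (f := QuotientGroup.mk' N) (hfin.subset ?_) 
        (hX2.injOn.mono Set.inter_subset_left)
      rintro _ ⟨x, hx, rfl⟩; exact hx.2
    · ext s
      constructor
      · rintro ⟨x, hx, rfl⟩; exact hx.2
      · intro hs
        obtain ⟨x, hx, rfl⟩ := hX2.surjOn (hsub hs)
        exact ⟨x, ⟨hx, hs⟩, rfl⟩
  refine ⟨X, hX, hXH, ?_⟩
  intro g hg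
  have h1 : QuotientGroup.mk' N g ∈ (Subgroup.closure X).map (QuotientGroup.mk' N) := by
    rw [MonoidHom.map_closure, hXS, hS]; exact ⟨g, hg, rfl⟩
  have h2 : g ∈ ((Subgroup.closure X).map (QuotientGroup.mk' N)).comap (QuotientGroup.mk' N) := h1
  rwa [Subgroup.comap_map_eq, QuotientGroup.ker_mk'] at h2

/-- subgroups of a central f.g. subgroup are f.g. -/
lemma fg_of_le_central {G : Type*} [Group G] (Z : Subgroup G) (hZ : Z ≤ Subgroup.center G)
    (hfg : Z.FG) (H : Subgroup G) (hH : H ≤ Z) : H.FG := by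
  letI : CommGroup Z := { (inferInstance : Group Z) with
    mul_comm := fun a b => Subtype.ext ((Subgroup.mem_center_iff.1 (hZ b.2) a)) }
  haveI : Group.FG Z := (Group.fg_iff_subgroup_fg Z).2 hfg
  haveI : Module.Finite ℤ (Additive Z) := Module.Finite.iff_addGroup_fg.2 inferInstance
  haveI : IsNoetherian ℤ (Additive Z) := inferInstance
  have h1 := IsNoetherian.noetherian (AddSubgroup.toIntSubmodule (Subgroup.toAddSubgroup (H.subgroupOf Z)))
  have h2 : (Subgroup.toAddSubgroup (H.subgroupOf Z)).FG := by
    rw [← AddSubgroup.toIntSubmodule_toAddSubgroup (Subgroup.toAddSubgroup (H.subgroupOf Z)),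
      ← Submodule.fg_iff_addSubgroup_fg]
    exact h1
  have h3 : (H.subgroupOf Z).FG := (Subgroup.fg_iff_add_fg _).2 h2
  have h4 : ((H.subgroupOf Z).map Z.subtype).FG := by
    rw [Subgroup.fg_iff_submonoid_fg] at h3 ⊢
    exact h3.map Z.subtype
  rwa [Subgroup.map_subgroupOf_eq_of_le hH] at h4

lemma noeth_aux (n : ℕ) : ∀ (G : Type u) [Group G], Group.FG G →
    (⊤ : Subgroup G).lowerCentralSeries n = ⊥ → ∀ H : Subgroup G, H.FG := by
  induction n with
  | zero =>
    intro G _ _ h H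
    have : (⊤ : Subgroup G) = ⊥ := h
    have h2 : H = ⊥ := le_bot_iff.1 (this ▸ le_top)
    rw [h2]; exact Subgroup.FG.bot
  | succ n ih =>
    intro G _ hG h
    set Z := (⊤ : Subgroup G).lowerCentralSeries n with hZdef
    have hZc : Z ≤ Subgroup.center G := by
      rw [Subgroup.lowerCentralSeries_succ, Subgroup.commutator_eq_bot_iff_le_centralizer] at h
      intro z hz
      rw [Subgroup.mem_center_iff]
      intro g
      exact (Subgroup.mem_centralizer_iff.1 (h hz) g trivial)
    have hQ : ∀ H : Subgroup (G ⧸ Z), H.FG := by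
      apply ih (G ⧸ Z) inferInstance
      have := Subgroup.map_lowerCentralSeries (⊤ : Subgroup G) (QuotientGroup.mk' Z) n
      rw [Subgroup.map_top_of_surjective _ (QuotientGroup.mk'_surjective Z)] at this
      rw [← this, ← hZdef]
      simp
    have hZfg : Z.FG := by
      cases n with
      | zero =>
        have : Z = ⊤ := rfl
        rw [this]; exact Group.fg_def.1 hG
      | succ m =>
        obtain ⟨X, hXf, hXs, hX⟩ := exists_lift_fg Z ((⊤ : Subgroup G).lowerCentralSeries m) (hQ _)
        obtain ⟨S, hS, hSf⟩ := Group.fg_iff.1 hG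
        let T := Subgroup.closure (Set.image2 (fun x s => ⁅x, s⁆) X S)
        have hTZ : T ≤ Z := by
          rw [Subgroup.closure_le]
          rintro _ ⟨x, hx, s, hs, rfl⟩
          exact Subgroup.commutator_mem_commutator (hXs hx) trivial
        haveI : T.Normal := ⟨fun t ht g => by
          have := Subgroup.mem_center_iff.1 (hZc (hTZ ht)) g
          rw [this]; simpa using ht⟩
        have key : ∀ a b : G, ⁅a, b⁆ ∈ T ↔ Commute (a : G ⧸ T) (b : G ⧸ T) := by
          intro a b
          rw [← QuotientGroup.eq_one_iff, ← commutatorElement_eq_one_iff_commute]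
          rfl
        let C := (Subgroup.center (G ⧸ T)).comap (QuotientGroup.mk' T)
        have hXC : Subgroup.closure X ≤ C := by
          rw [Subgroup.closure_le]
          intro x hx
          have : Subgroup.closure S ≤ (Subgroup.centralizer {(x : G ⧸ T)}).comap (QuotientGroup.mk' T) := by
            rw [Subgroup.closure_le]
            intro s hs
            have h1 := (key x s).1 (Subgroup.subset_closure ⟨x, hx, s, hs, rfl⟩)
            show (s : G ⧸ T) ∈ Subgroup.centralizer {(x : G ⧸ T)}
            rw [Subgroup.mem_centralizer_singleton_iff]
            exact h1.symm
          rw [hS] at this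
          show (x : G ⧸ T) ∈ Subgroup.center _
          rw [Subgroup.mem_center_iff]
          intro g
          obtain ⟨g, rfl⟩ := QuotientGroup.mk_surjective g
          have h2 : (g : G ⧸ T) ∈ Subgroup.centralizer {(x : G ⧸ T)} := this (Subgroup.mem_top g)
          rw [Subgroup.mem_centralizer_singleton_iff] at h2
          exact h2
        have hZC : Z ≤ C := by
          intro z hz
          show (z : G ⧸ T) ∈ Subgroup.center _
          rw [Subgroup.mem_center_iff]
          intro g
          obtain ⟨g, rfl⟩ := QuotientGroup.mk_surjective g
          have := Subgroup.mem_center_iff.1 (hZc hz) g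
          rw [← QuotientGroup.mk_mul, this]; rfl
        have hle : Z ≤ T := by
          rw [hZdef, Subgroup.lowerCentralSeries_succ, Subgroup.commutator_le]
          intro g1 hg1 g2 _
          rw [key]
          have h1 : (g1 : G ⧸ T) ∈ Subgroup.center _ := (hX.trans (sup_le hXC hZC)) hg1
          exact (Subgroup.mem_center_iff.1 h1 _).symm
        have : Z = T := le_antisymm hle hTZ
        rw [this, Subgroup.fg_iff]
        exact ⟨_, rfl, hXf.image2 _ hSf⟩
    intro H
    obtain ⟨X, hXf, hXs, hX⟩ := exists_lift_fg Z H (hQ _)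
    have h1 : (H ⊓ Z).FG := fg_of_le_central Z hZc hZfg _ inf_le_right
    have h2 : H = Subgroup.closure X ⊔ (H ⊓ Z) := by
      apply le_antisymm
      · intro g hg
        obtain ⟨a, ha, z, hz, rfl⟩ := Subgroup.mem_sup_of_normal_right.1 (hX hg)
        have haH : a ∈ H := (Subgroup.closure_le H).2 hXs ha
        exact Subgroup.mul_mem_sup ha ⟨(Subgroup.mul_mem_cancel_left H haH).1 hg, hz⟩
      · exact sup_le ((Subgroup.closure_le H).2 hXs) inf_le_left
    rw [h2]
    exact Subgroup.FG.sup ((Subgroup.fg_iff _).2 ⟨X, rfl, hXf⟩) h1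

lemma noeth (G : Type u) [Group G] (hfg : Group.FG G) (hnil : Group.IsNilpotent G)
    (H : Subgroup G) : H.FG := by
  obtain ⟨n, hn⟩ := Subgroup.nilpotent_iff_lowerCentralSeries.1 hnil
  exact noeth_aux n G hfg hn H

lemma wf_of_noeth (G : Type u) [Group G] (h : ∀ H : Subgroup G, H.FG) :
    WellFoundedGT (Subgroup G) := by
  rw [wellFoundedGT_iff_monotone_chain_condition]
  intro f
  obtain ⟨S, hS, hf⟩ := (Subgroup.fg_iff _).1 (h (⨆ n, f n))
  have h1 : ∀ s ∈ S, ∃ n, s ∈ f n := by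
    intro s hs
    have : s ∈ ⨆ n, f n := by rw [← hS]; exact Subgroup.subset_closure hs
    exact (Subgroup.mem_iSup_of_directed (f.monotone.directed_le)).1 this
  choose! n hn using h1
  obtain ⟨N, hN⟩ := (hf.image n).bddAbove
  refine ⟨N, fun m hm => le_antisymm (f.monotone hm) ?_⟩
  refine (le_iSup (fun n => f n) m).trans ?_
  rw [← hS, Subgroup.closure_le]
  intro s hs
  exact f.monotone (hN ⟨s, hs, rfl⟩) (hn s hs)

/-- torsion centre implies finite -/
lemma finite_of_center_torsion (G : Type u) [Group G] (hnil : Group.IsNilpotent G)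
    : Group.FG G → (∀ z ∈ Subgroup.center G, IsOfFinOrder z) → Finite G := by
  refine Group.nilpotent_center_quotient_ind 
    (P := fun G _ _ => Group.FG G → (∀ z ∈ Subgroup.center G, IsOfFinOrder z) → Finite G) G ?_ ?_
  · intros; infer_instance
  · intro G i1 i2 ih
    intro hfg ht
    haveI hZfg : Group.FG (Subgroup.center G) :=
      (Group.fg_iff_subgroup_fg _).2 (noeth G hfg i2 _)
    haveI : Finite (Subgroup.center G) := by
      letI : CommGroup (Subgroup.center G) := { (inferInstance : Group (Subgroup.center G)) with
        mul_comm := fun a b => Subtype.ext ((Subgroup.mem_center_iff.1 b.2 a)) }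
      refine @CommGroup.finite_of_fg_isMulTorsion (Subgroup.center G) this hZfg ?_
      intro z
      rw [← Submonoid.isOfFinOrder_coe]
      exact ht z z.2
    haveI : Finite (G ⧸ Subgroup.center G) := by
      apply ih inferInstance
      intro z hz
      obtain ⟨x, rfl⟩ := QuotientGroup.mk_surjective z
      rw [isOfFinOrder_iff_pow_eq_one]
      refine ⟨Nat.card (Subgroup.center G), Nat.card_pos, ?_⟩
      rw [← QuotientGroup.mk_pow, QuotientGroup.eq_one_iff, Subgroup.mem_center_iff]
      intro g
      have h1 : g * x * g⁻¹ * x⁻¹ ∈ Subgroup.center G := by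
        rw [← QuotientGroup.eq_one_iff]
        have := Subgroup.mem_center_iff.1 hz g
        simp only [QuotientGroup.mk_mul, QuotientGroup.mk_inv, this]
        group
      have h2 := Subgroup.mem_center_iff.1 h1
      have h3 : (g * x * g⁻¹ * x⁻¹) ^ Nat.card (Subgroup.center G) = 1 := by
        have := pow_card_eq_one' (G := Subgroup.center G) (x := ⟨_, h1⟩)
        exact congrArg Subtype.val this
      have h4 : (g * x * g⁻¹) ^ Nat.card (Subgroup.center G) = x ^ Nat.card (Subgroup.center G) := by
        have h5 : g * x * g⁻¹ = (g * x * g⁻¹ * x⁻¹) * x := by group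
        rw [h5, Commute.mul_pow (h2 x).symm, h3, one_mul]
      rw [conj_pow] at h4
      rw [mul_inv_eq_iff_eq_mul] at h4
      exact h4
    exact Finite.of_subgroup_quotient (Subgroup.center G)

lemma exists_inforder_center (G : Type u) [Group G] [Infinite G] (hnil : Group.IsNilpotent G)
    (hfg : Group.FG G) : ∃ z ∈ Subgroup.center G, ¬ IsOfFinOrder z := by
  by_contra! h
  exact not_finite_iff_infinite.2 ‹Infinite G› (finite_of_center_torsion G hnil hfg h)

lemma orbit_aux {Q P : Type*} [Group Q] [Group P] (α β : P →* Q) (x y z : Q)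
    (hz : z ∈ Subgroup.center Q)
    (h : ∀ n : ℕ, 0 < n → ∃ p, ∃ r : ℤ, α p * x * (β p)⁻¹ = y * z ^ ((n : ℤ) * r)) :
    ∃ p, α p * x * (β p)⁻¹ = y := by
  have hc : ∀ (i : ℤ) (g : Q), z ^ i * g = g * z ^ i := fun i g =>
    (Subgroup.mem_center_iff.1 (Subgroup.zpow_mem _ hz i) g).symm
  obtain ⟨p0, j0, h0⟩ := h 1 one_pos
  rw [Nat.cast_one, one_mul] at h0
  by_cases hJ : ∀ p, ∀ j : ℤ, α p * x * (β p)⁻¹ = y * z ^ j → j = j0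
  · obtain ⟨p, r, hp⟩ := h (j0.natAbs + 1) (by omega)
    have h1 := hJ p _ hp
    have h2 : j0 = 0 := by
      by_contra hne
      have : ((j0.natAbs + 1 : ℕ) : ℤ) ∣ j0 := ⟨r, h1.symm⟩
      have := Int.natAbs_dvd_natAbs.2 this
      rw [Int.natAbs_natCast] at this
      have := Nat.le_of_dvd (by omega) this
      omega
    exact ⟨p0, by rw [h0, h2]; simp⟩
  · push Not at hJ
    obtain ⟨p1, j1, h1, hne⟩ := hJ
    obtain ⟨d, hd⟩ : ∃ d, d = j1 - j0 := ⟨_, rfl⟩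
    have hstep : ∀ r : ℤ, ∃ q, α q * y * (β q)⁻¹ = y * z ^ (d * r) := by
      have hq : α (p1 * p0⁻¹) * y * (β (p1 * p0⁻¹))⁻¹ = y * z ^ d := by
        have hy : y = α p0 * x * (β p0)⁻¹ * z ^ (-j0) := by rw [h0]; simp
        have : α (p1 * p0⁻¹) * y * (β (p1 * p0⁻¹))⁻¹ = α p1 * x * (β p1)⁻¹ * z ^ (-j0) := by
          conv_lhs => rw [hy]
          simp only [map_mul, map_inv, mul_inv_rev, inv_inv, mul_assoc, hc, inv_mul_cancel_left]
        rw [this, h1, mul_assoc, ← zpow_add, hd, sub_eq_add_neg]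
      generalize p1 * p0⁻¹ = q at hq
      have hnat : ∀ n : ℕ, α (q ^ n) * y * (β (q ^ n))⁻¹ = y * z ^ (d * n) := by
        intro n
        induction n with
        | zero => simp
        | succ n ihn =>
          have : α (q ^ (n + 1)) * y * (β (q ^ (n + 1)))⁻¹ =
              α q * (α (q ^ n) * y * (β (q ^ n))⁻¹) * (β q)⁻¹ := by
            rw [pow_succ']; simp only [map_mul, mul_inv_rev, mul_assoc]
          rw [this, ihn, mul_assoc, mul_assoc, hc, ← mul_assoc, ← mul_assoc, hq, mul_assoc,
            ← zpow_add]
          congr 2; push_cast; ring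
      intro r
      obtain ⟨n, rfl | rfl⟩ := r.eq_nat_or_neg
      · exact ⟨_, hnat n⟩
      · refine ⟨(q ^ n)⁻¹, ?_⟩
        have := hnat n
        have h6 : y = (α (q ^ n))⁻¹ * (y * z ^ (d * n)) * β (q ^ n) := by rw [← this]; group
        have h7 : (α (q ^ n))⁻¹ * y * β (q ^ n) * z ^ (d * n) = y := by
          conv_rhs => rw [h6]
          simp only [mul_assoc, hc]
        rw [map_inv, map_inv, inv_inv, mul_neg, zpow_neg, eq_mul_inv_iff_mul_eq]
        exact h7
    obtain ⟨p, r, hp⟩ := h d.natAbs (by omega)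
    obtain ⟨e, he⟩ : ∃ e, ((d.natAbs : ℤ) * r) = d * e := by
      obtain h8 | h8 := Int.natAbs_eq d
      · exact ⟨r, by rw [← h8]⟩
      · refine ⟨-r, ?_⟩
        conv_rhs => rw [h8]
        ring
    obtain ⟨q, hq⟩ := hstep (-e)
    refine ⟨q * p, ?_⟩
    have : α (q * p) * x * (β (q * p))⁻¹ = α q * (α p * x * (β p)⁻¹) * (β q)⁻¹ := by
      simp only [map_mul, mul_inv_rev, mul_assoc]
    rw [this, hp, he, mul_assoc, mul_assoc, hc, ← mul_assoc, ← mul_assoc, hq, mul_assoc, ← zpow_add]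
    simp

/-- Separation theorem for f.g. nilpotent groups. -/
theorem sep (G : Type u) [Group G] (hnil : Group.IsNilpotent G) (hfg : Group.FG G)
    {P : Type*} [Group P] (α β : P →* G) (x y : G) (h : ∀ p, α p * x * (β p)⁻¹ ≠ y) :
    ∃ N : Subgroup G, N.Normal ∧ N.FiniteIndex ∧ ∀ p, y⁻¹ * (α p * x * (β p)⁻¹) ∉ N := by
  haveI := wf_of_noeth G (noeth G hfg hnil)
  obtain ⟨N, ⟨hN, hNp⟩, hmax⟩ := (wellFounded_gt (α := Subgroup G)).has_min
    {N : Subgroup G | N.Normal ∧ ∀ p, y⁻¹ * (α p * x * (β p)⁻¹) ∉ N}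
    ⟨⊥, inferInstance, fun p hp => h p (by
      rw [Subgroup.mem_bot, inv_mul_eq_one] at hp; exact hp.symm)⟩
  refine ⟨N, hN, ?_, hNp⟩
  by_contra hfi
  haveI : Infinite (G ⧸ N) := by
    rw [← not_finite_iff_infinite]
    intro hf
    exact hfi Subgroup.finiteIndex_of_finite_quotient
  obtain ⟨z, hz, hzo⟩ := exists_inforder_center (G ⧸ N) inferInstance inferInstance
  have := orbit_aux ((QuotientGroup.mk' N).comp α) ((QuotientGroup.mk' N).comp β)
    (x : G ⧸ N) (y : G ⧸ N) z hz (by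
    intro n hn
    let Z := Subgroup.zpowers (z ^ n)
    haveI : Z.Normal := by
      constructor
      intro a ha g
      have hac : a ∈ Subgroup.center (G ⧸ N) := 
        (Subgroup.zpowers_le.2 (Subgroup.pow_mem _ hz n)) ha
      rw [Subgroup.mem_center_iff.1 hac g]; simpa using ha
    have hlt : N < Z.comap (QuotientGroup.mk' N) := by
      refine lt_of_le_of_ne ?_ ?_
      · intro g hg
        show (g : G ⧸ N) ∈ Z
        rw [(QuotientGroup.eq_one_iff g).2 hg]; exact Z.one_mem
      · intro heq
        obtain ⟨g, hg⟩ := QuotientGroup.mk_surjective (z ^ n)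
        have : g ∈ Z.comap (QuotientGroup.mk' N) := by
          show (g : G ⧸ N) ∈ Z
          rw [hg]; exact Subgroup.mem_zpowers _
        rw [← heq, ← QuotientGroup.eq_one_iff, hg] at this
        exact hzo (isOfFinOrder_iff_pow_eq_one.2 ⟨n, hn, this⟩)
    have h2 : ¬ ((Z.comap (QuotientGroup.mk' N)).Normal ∧
        ∀ p, y⁻¹ * (α p * x * (β p)⁻¹) ∉ Z.comap (QuotientGroup.mk' N)) :=
      fun hh => hmax _ hh hlt
    have h3 : ∃ p, y⁻¹ * (α p * x * (β p)⁻¹) ∈ Z.comap (QuotientGroup.mk' N) := by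
      by_contra! h4
      exact h2 ⟨inferInstance, h4⟩
    obtain ⟨p, hp⟩ := h3
    obtain ⟨r, hr⟩ := Subgroup.mem_zpowers_iff.1 (Subgroup.mem_comap.1 hp)
    refine ⟨p, r, ?_⟩
    rw [zpow_mul, zpow_natCast, hr]
    simp)
  obtain ⟨p, hp⟩ := this
  apply hNp p
  rw [← QuotientGroup.eq]
  exact hp.symm

end WNil
namespace WNil

lemma fin_inter {G : Type*} [Group G] {ι : Type*} (F : Set ι) (hF : F.Finite)
    (p : ι → Subgroup G → Prop) (hp : ∀ i N N', N' ≤ N → p i N → p i N')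
    (h : ∀ i ∈ F, ∃ N : Subgroup G, N.Normal ∧ N.FiniteIndex ∧ p i N) :
    ∃ N : Subgroup G, N.Normal ∧ N.FiniteIndex ∧ ∀ i ∈ F, p i N := by
  induction F, hF using Set.Finite.induction_on with
  | empty => exact ⟨⊤, inferInstance, inferInstance, by simp⟩
  | insert _ _ ih =>
    rename_i a s ha hs
    obtain ⟨N, h1, h2, h3⟩ := ih (fun i hi => h i (Set.mem_insert_of_mem _ hi))
    obtain ⟨N', h1', h2', h3'⟩ := h a (Set.mem_insert _ _)
    refine ⟨N ⊓ N', inferInstance, inferInstance, ?_⟩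
    rintro i (rfl | hi)
    · exact hp _ _ _ inf_le_right h3'
    · exact hp _ _ _ inf_le_left (h3 i hi)

lemma sep_zpowers (G : Type u) [Group G] (hnil : Group.IsNilpotent G) (hfg : Group.FG G)
    (c : G) (F : Set G) (hF : F.Finite) :
    ∃ N : Subgroup G, N.Normal ∧ N.FiniteIndex ∧
      ∀ g ∈ F, g ∈ Subgroup.zpowers c ⊔ N → g ∈ Subgroup.zpowers c := by
  refine fin_inter F hF (fun g N => g ∈ Subgroup.zpowers c ⊔ N → g ∈ Subgroup.zpowers c) ?_ ?_
  · intro i N N' hle h hi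
    exact h (sup_le_sup_left hle _ hi)
  · intro g _
    by_cases hg : g ∈ Subgroup.zpowers c
    · exact ⟨⊤, inferInstance, inferInstance, fun _ => hg⟩
    · obtain ⟨N, h1, h2, h3⟩ := sep G hnil hfg (Subgroup.zpowers c).subtype 1 1 g (by
        rintro ⟨p, hp⟩ h
        apply hg
        simp at h
        exact h ▸ hp)
      refine ⟨N, h1, h2, fun h => ?_⟩
      obtain ⟨a, ha, b, hb, rfl⟩ := Subgroup.mem_sup_of_normal_right.1 h
      exfalso
      apply h3 ⟨a, ha⟩
      simpa [mul_assoc] using hb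

section mod
variable {G : Type u} [Group G] {V : Type u} [AddCommGroup V]

/-- translation on finitely supported functions -/
noncomputable def T (c : G) : (G →₀ V) →+ (G →₀ V) := Finsupp.mapDomain.addMonoidHom (c * ·)

lemma T_single (c g : G) (v : V) : T c (Finsupp.single g v) = Finsupp.single (c * g) v := by
  simp [T]

lemma T_mul (c d : G) (m : G →₀ V) : T (c * d) m = T c (T d m) := by
  simp only [T, Finsupp.mapDomain.addMonoidHom_apply]
  rw [← Finsupp.mapDomain_comp]
  congr 1
  funext x
  simp [mul_assoc]

lemma T_one (m : G →₀ V) : T 1 m = m := by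
  simp only [T, Finsupp.mapDomain.addMonoidHom_apply, one_mul]
  exact Finsupp.mapDomain_id

/-- right coset projection -/
def rq (C : Subgroup G) (g : G) : Quotient (QuotientGroup.rightRel C) := Quotient.mk _ g

lemma rq_eq (C : Subgroup G) (g h : G) : rq C g = rq C h ↔ h * g⁻¹ ∈ C := by
  rw [rq, rq, Quotient.eq, QuotientGroup.rightRel_apply]

/-- image of `1 - c` -/
noncomputable def Im (V : Type u) [AddCommGroup V] (c : G) : AddSubgroup (G →₀ V) :=
  (AddMonoidHom.id (G →₀ V) - T c).range

lemma mem_Im (c : G) (m : G →₀ V) : m ∈ Im V c ↔ ∃ h, h - T c h = m := Iff.rfl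

lemma single_mem_Im (c g d : G) (hd : d ∈ Subgroup.zpowers c) (v : V) :
    Finsupp.single g v - Finsupp.single (d * g) v ∈ Im V c := by
  have hle : Subgroup.zpowers c ≤
      { carrier := {d | ∀ m : G →₀ V, m - T d m ∈ Im V c}
        one_mem' := by intro m; simp [T_one, AddSubgroup.zero_mem]
        mul_mem' := by
          intro a b ha hb m
          have := AddSubgroup.add_mem _ (ha (T b m)) (hb m)
          rw [T_mul]
          convert this using 1
          abel
        inv_mem' := by
          intro a ha m
          have := AddSubgroup.neg_mem _ (ha (T a⁻¹ m))
          rw [← T_mul, mul_inv_cancel, T_one] at this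
          convert this using 1
          abel } := by
    rw [Subgroup.zpowers_le]
    intro m
    exact ⟨m, rfl⟩
  have := hle hd (Finsupp.single g v)
  rwa [T_single] at this

lemma mapDomain_T_rq (c d : G) (hd : d ∈ Subgroup.zpowers c) (C : Subgroup G) (hC : Subgroup.zpowers c ≤ C)
    (m : G →₀ V) :
    Finsupp.mapDomain (rq C) (T d m) = Finsupp.mapDomain (rq C) m := by
  simp only [T, Finsupp.mapDomain.addMonoidHom_apply]
  rw [← Finsupp.mapDomain_comp]
  congr 1
  funext x
  rw [Function.comp, rq_eq]
  have := C.inv_mem (hC hd)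
  simpa using this

lemma mem_Im_iff (c : G) (m : G →₀ V) :
    m ∈ Im V c ↔ Finsupp.mapDomain (rq (Subgroup.zpowers c)) m = 0 := by
  constructor
  · rintro ⟨h, rfl⟩
    show Finsupp.mapDomain _ (h - T c h) = 0
    have := (Finsupp.mapDomain.addMonoidHom (M := V) (rq (Subgroup.zpowers c))).map_sub h (T c h)
    simp only [Finsupp.mapDomain.addMonoidHom_apply] at this
    rw [this, mapDomain_T_rq c c (Subgroup.mem_zpowers c) _ le_rfl, sub_self]
  · intro h0
    have key : m - Finsupp.mapDomain Quotient.out (Finsupp.mapDomain (rq (Subgroup.zpowers c)) m) ∈ Im V c := by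
      clear h0
      induction m using Finsupp.induction_linear with
      | zero => simp [AddSubgroup.zero_mem]
      | add f g hf hg =>
        rw [Finsupp.mapDomain_add, Finsupp.mapDomain_add]
        convert AddSubgroup.add_mem _ hf hg using 1
        abel
      | single a b =>
        rw [Finsupp.mapDomain_single, Finsupp.mapDomain_single]
        have h1 : rq (Subgroup.zpowers c) a = rq _ (rq (Subgroup.zpowers c) a).out :=
          (Quotient.out_eq (rq (Subgroup.zpowers c) a)).symm
        rw [rq_eq] at h1
        have := single_mem_Im c a _ h1 b
        simpa using this
    rwa [h0, Finsupp.mapDomain_zero, sub_zero] at key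

lemma mapDomain_mem {X Y : Type*} (φ : X → Y) (V0 : AddSubgroup V) (m : X →₀ V)
    (h : ∀ x, m x ∈ V0) (y : Y) : Finsupp.mapDomain φ m y ∈ V0 := by
  classical
  rw [Finsupp.mapDomain, Finsupp.sum_apply]
  refine AddSubgroup.sum_mem _ fun x _ => ?_
  simp only [Finsupp.single_apply]
  split_ifs
  · exact h x
  · exact V0.zero_mem

/-- kernel of reduction -/
noncomputable def Ker (V0 : AddSubgroup V) (L : Subgroup G) : AddSubgroup (G →₀ V) where
  carrier := {m | ∀ j : G ⧸ L, Finsupp.mapDomain (fun g : G => (g : G ⧸ L)) m j ∈ V0}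
  zero_mem' := by intro j; simp [V0.zero_mem]
  add_mem' := by
    intro a b ha hb j
    rw [Finsupp.mapDomain_add]
    exact V0.add_mem (ha j) (hb j)
  neg_mem' := by
    intro a ha j
    have := (Finsupp.mapDomain.addMonoidHom (M := V) (fun g : G => (g : G ⧸ L))).map_neg a
    simp only [Finsupp.mapDomain.addMonoidHom_apply] at this
    rw [this]
    exact V0.neg_mem (ha j)

lemma mem_Ker (V0 : AddSubgroup V) (L : Subgroup G) (m : G →₀ V) :
    m ∈ Ker V0 L ↔ ∀ j : G ⧸ L, Finsupp.mapDomain (fun g : G => (g : G ⧸ L)) m j ∈ V0 := Iff.rfl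

lemma Ker_push {X : Type*} (V0 : AddSubgroup V) (L : Subgroup G) (φ : G → X)
    (hφ : ∀ g l, l ∈ L → φ (g * l) = φ g) (m : G →₀ V) (hm : m ∈ Ker V0 L) (x : X) :
    Finsupp.mapDomain φ m x ∈ V0 := by
  let ψ : G ⧸ L → X := fun j => φ j.out
  have : φ = ψ ∘ (fun g : G => (g : G ⧸ L)) := by
    funext g
    obtain ⟨l, hl⟩ := QuotientGroup.mk_out_eq_mul L g
    show φ g = φ ((g : G ⧸ L).out)
    rw [hl, hφ _ _ l.2]
  rw [this, Finsupp.mapDomain_comp]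
  exact mapDomain_mem _ _ _ hm _

lemma Ker_mono (V0 V1 : AddSubgroup V) (L L' : Subgroup G) (hV : V1 ≤ V0) (hL : L' ≤ L) :
    Ker V1 L' ≤ Ker V0 L := by
  intro m hm j
  refine hV (Ker_push V1 L' _ ?_ m hm j)
  intro g l hl
  rw [eq_comm, QuotientGroup.eq]
  simpa using hL hl

lemma mapDomain_T_mk (c : G) (L : Subgroup G) (m : G →₀ V) (j : G ⧸ L) :
    Finsupp.mapDomain (fun g : G => (g : G ⧸ L)) (T c m) j =
      Finsupp.mapDomain (fun g : G => (g : G ⧸ L)) m (c⁻¹ • j) := by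
  have h1 : Finsupp.mapDomain (fun g : G => (g : G ⧸ L)) (T c m) =
      Finsupp.mapDomain (fun j : G ⧸ L => c • j) (Finsupp.mapDomain (fun g : G => (g : G ⧸ L)) m) := by
    simp only [T, Finsupp.mapDomain.addMonoidHom_apply]
    rw [← Finsupp.mapDomain_comp, ← Finsupp.mapDomain_comp]
    rfl
  rw [h1]
  conv_lhs => rw [← smul_inv_smul c j]
  exact Finsupp.mapDomain_apply (MulAction.injective c) _ _

lemma T_mem_Ker (c : G) (V0 : AddSubgroup V) (L : Subgroup G) (m : G →₀ V) (hm : m ∈ Ker V0 L) :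
    T c m ∈ Ker V0 L := by
  intro j
  rw [mapDomain_T_mk]
  exact hm _

lemma T_sub_mem_Ker (l : G) (V0 : AddSubgroup V) (L : Subgroup G) [L.Normal] (hl : l ∈ L) (m : G →₀ V) :
    T l m - m ∈ Ker V0 L := by
  intro j
  have := (Finsupp.mapDomain.addMonoidHom (M := V) (fun g : G => (g : G ⧸ L))).map_sub (T l m) m
  simp only [Finsupp.mapDomain.addMonoidHom_apply] at this
  rw [this, Finsupp.sub_apply, mapDomain_T_mk]
  have h2 : l⁻¹ • j = j := by
    obtain ⟨g, rfl⟩ := QuotientGroup.mk_surjective j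
    rw [MulAction.Quotient.smul_mk, QuotientGroup.eq]
    have := (inferInstance : L.Normal).conj_mem l hl g⁻¹
    simpa [mul_assoc] using this
  rw [h2, sub_self]
  exact V0.zero_mem

end mod
end WNil

namespace WNil
section mod2
variable {G : Type u} [Group G] {V : Type u} [AddCommGroup V]

lemma lemA (hnil : Group.IsNilpotent G) (hfg : Group.FG G) (b c : G)
    (L0 : Subgroup G) (hn : L0.Normal) (hf : L0.FiniteIndex) :
    ∃ L : Subgroup G, L.Normal ∧ L.FiniteIndex ∧ L ≤ L0 ∧
      ∀ k, k * b * k⁻¹ * c⁻¹ ∈ L → ∃ k', k' * k⁻¹ ∈ L0 ∧ k' * b * k'⁻¹ = c := by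
  haveI : Finite (G ⧸ L0) := Subgroup.finite_quotient_of_finiteIndex
  obtain ⟨N, h1, h2, h3⟩ := fin_inter (G := G) (Set.univ : Set (G ⧸ L0)) Set.finite_univ
    (fun j N => ∀ k : G, (k : G ⧸ L0) = j → k * b * k⁻¹ * c⁻¹ ∈ N →
      ∃ k', k' * k⁻¹ ∈ L0 ∧ k' * b * k'⁻¹ = c)
    (by
      intro j N N' hle h k hk hm
      exact h k hk (hle hm))
    (by
      intro j _
      obtain ⟨k0, rfl⟩ := QuotientGroup.mk_surjective j
      by_cases hex : ∃ k', k' * k0⁻¹ ∈ L0 ∧ k' * b * k'⁻¹ = c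
      · obtain ⟨k', hk', hc⟩ := hex
        refine ⟨⊤, inferInstance, inferInstance, ?_⟩
        intro k hk _
        refine ⟨k', ?_, hc⟩
        rw [QuotientGroup.eq] at hk
        have := hn.conj_mem _ hk k
        have h4 : k' * k⁻¹ = (k' * k0⁻¹) * (k * (k⁻¹ * k0) * k⁻¹) := by group
        rw [h4]
        exact L0.mul_mem hk' this
      · push Not at hex
        obtain ⟨N, h1, h2, h3⟩ := sep G hnil hfg L0.subtype L0.subtype (k0 * b * k0⁻¹) c (by
          rintro ⟨p, hp⟩ h
          apply hex (p * k0) (by simpa using hp)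
          rw [← h]
          simp [mul_assoc])
        refine ⟨N, h1, h2, ?_⟩
        intro k hk hm
        exfalso
        rw [QuotientGroup.eq] at hk
        have h5 : k * k0⁻¹ ∈ L0 := by
          have := L0.inv_mem (hn.conj_mem _ hk k)
          have h4 : k * k0⁻¹ = (k * (k⁻¹ * k0) * k⁻¹)⁻¹ := by group
          rwa [h4]
        apply h3 ⟨k * k0⁻¹, h5⟩
        have := h1.conj_mem _ hm c⁻¹
        convert this using 1
        simp only [Subgroup.subtype_apply]
        group)
  haveI := h1
  haveI := h2
  exact ⟨N ⊓ L0, inferInstance, inferInstance, inf_le_right, fun k hk => h3 k trivial k rfl hk.1⟩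

lemma mapDomain_sub' {X Y : Type*} (φ : X → Y) (a b : X →₀ V) :
    Finsupp.mapDomain φ (a - b) = Finsupp.mapDomain φ a - Finsupp.mapDomain φ b := by
  have := (Finsupp.mapDomain.addMonoidHom (M := V) φ).map_sub a b
  simpa only [Finsupp.mapDomain.addMonoidHom_apply] using this

lemma mapDomain_T_rq' (d : G) (C : Subgroup G) (hC : d ∈ C) (m : G →₀ V) :
    Finsupp.mapDomain (rq C) (T d m) = Finsupp.mapDomain (rq C) m :=
  mapDomain_T_rq d d (Subgroup.mem_zpowers d) C (Subgroup.zpowers_le.2 hC) m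

lemma cmp {X Y : Type*} (φ : G → X) (ψ : G → Y) (E : Set G) 
    (hE : ∀ e ∈ E, ∀ e' ∈ E, φ e = φ e' ↔ ψ e = ψ e') (m : G →₀ V) (hm : ∀ g ∈ m.support, g ∈ E)
    (e : G) (he : e ∈ E) : Finsupp.mapDomain φ m (φ e) = Finsupp.mapDomain ψ m (ψ e) := by
  classical
  rw [Finsupp.mapDomain, Finsupp.mapDomain, Finsupp.sum_apply, Finsupp.sum_apply]
  refine Finset.sum_congr rfl fun x hx => ?_
  simp only [Finsupp.single_apply, hE x (hm x hx) e he]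

lemma exists_of_mapDomain_ne {X Y : Type*} (φ : X → Y) (m : X →₀ V) (y : Y)
    (h : Finsupp.mapDomain φ m y ≠ 0) : ∃ x ∈ m.support, φ x = y := by
  classical
  have h1 : y ∈ (Finsupp.mapDomain φ m).support := Finsupp.mem_support_iff.2 h
  have := Finsupp.mapDomain_support h1
  simpa [Finset.mem_image] using this

lemma exists_V1 (hV : ∀ v : V, v ≠ 0 → ∃ N : AddSubgroup V, N.FiniteIndex ∧ v ∉ N)
    (V0 : AddSubgroup V) (h0 : V0.FiniteIndex) (F : Set V) (hF : F.Finite) :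
    ∃ V1 : AddSubgroup V, V1.FiniteIndex ∧ V1 ≤ V0 ∧ ∀ v ∈ F, v ∈ V1 → v = 0 := by
  induction F, hF using Set.Finite.induction_on with
  | empty => exact ⟨V0, h0, le_rfl, by simp⟩
  | insert _ _ ih =>
    rename_i a s ha hs
    obtain ⟨V1, h1, h2, h3⟩ := ih
    by_cases h : a = 0
    · refine ⟨V1, h1, h2, ?_⟩
      rintro v (rfl | hv) h4
      · exact h
      · exact h3 v hv h4
    · obtain ⟨N, hN, haN⟩ := hV a h
      refine ⟨V1 ⊓ N, inferInstance, inf_le_left.trans h2, ?_⟩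
      rintro v (rfl | hv) h4
      · exact absurd h4.2 haN
      · exact h3 v hv h4.1

lemma T_support (u : G) (f : G →₀ V) (x : G) (hx : x ∈ (T u f).support) : ∃ s ∈ f.support, u * s = x := by
  simp only [T, Finsupp.mapDomain.addMonoidHom_apply] at hx
  exact exists_of_mapDomain_ne _ _ _ (Finsupp.mem_support_iff.1 hx)

lemma lemB (hnil : Group.IsNilpotent G) (hfg : Group.FG G)
    (hV : ∀ v : V, v ≠ 0 → ∃ N : AddSubgroup V, N.FiniteIndex ∧ v ∉ N)
    (b c : G) (f g : G →₀ V) (hg : Finsupp.mapDomain (rq (Subgroup.zpowers c)) g ≠ 0)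
    (L0 : Subgroup G) (hn : L0.Normal) (hf : L0.FiniteIndex)
    (V0 : AddSubgroup V) (h0 : V0.FiniteIndex) :
    ∃ L : Subgroup G, L.Normal ∧ L.FiniteIndex ∧ L ≤ L0 ∧
    ∃ V1 : AddSubgroup V, V1.FiniteIndex ∧ V1 ≤ V0 ∧
      ∀ k, ∀ h : G →₀ V, k * b * k⁻¹ * c⁻¹ ∈ L → h + T k f - T c h - g ∈ Ker V1 L →
        ∃ k', k' * k⁻¹ ∈ L0 ∧ k' * b * k'⁻¹ = c ∧ T k' f - g ∈ Im V c := by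
  classical
  set π := rq (Subgroup.zpowers c) with hπ
  let U : Set G := Set.image2 (fun t s => t * s⁻¹) g.support f.support
  have hU : U.Finite := Set.Finite.image2 _ (Finset.finite_toSet _) (Finset.finite_toSet _)
  let E : Set G := g.support ∪ Set.image2 (fun u s => u * s) U f.support
  have hE : E.Finite := (Finset.finite_toSet _).union (hU.image2 _ (Finset.finite_toSet _))
  obtain ⟨L1, hL1n, hL1f, hL1⟩ := sep_zpowers G hnil hfg c
    (Set.image2 (fun e e' => e' * e⁻¹) E E) (hE.image2 _ hE)
  obtain ⟨L2, hL2n, hL2f, hL2⟩ := sep_zpowers G hnil hfg 1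
    ((fun u => u * b * u⁻¹ * c⁻¹) '' U) (hU.image _)
  let F : Set V := Set.range (Finsupp.mapDomain π g) ∪
    ⋃ u ∈ U, Set.range (Finsupp.mapDomain π (T u f - g))
  have hF : F.Finite := by
    refine (Finsupp.finite_range _).union (hU.biUnion fun u _ => Finsupp.finite_range _)
  obtain ⟨V1, hV1f, hV1le, hV1⟩ := exists_V1 hV V0 h0 F hF
  refine ⟨L0 ⊓ L1 ⊓ L2, inferInstance, inferInstance, inf_le_left.trans inf_le_left,
    V1, hV1f, hV1le, ?_⟩
  set L := L0 ⊓ L1 ⊓ L2 with hL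
  haveI hLn : L.Normal := inferInstance
  intro k h hk hker
  let C := Subgroup.zpowers c ⊔ L
  have hLL1 : L ≤ L1 := inf_le_left.trans inf_le_right
  have hLL2 : L ≤ L2 := inf_le_right
  have hCL1 : C ≤ Subgroup.zpowers c ⊔ L1 := sup_le_sup_left hLL1 _
  have hcC : Subgroup.zpowers c ≤ C := le_sup_left
  have hLC : L ≤ C := le_sup_right
  have hCn : ∀ (g l : G), l ∈ L → rq C (g * l) = rq C g := by
    intro g l hl
    rw [rq_eq]
    apply hLC
    have := hLn.conj_mem _ (L.inv_mem hl) g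
    convert this using 1
    group
  have hEE : ∀ e ∈ E, ∀ e' ∈ E, rq C e = rq C e' ↔ π e = π e' := by
    intro e he e' he'
    rw [hπ, rq_eq, rq_eq]
    constructor
    · intro hh
      exact hL1 _ ⟨e, he, e', he', rfl⟩ (hCL1 hh)
    · exact fun hh => hcC hh
  have hval : ∀ x, Finsupp.mapDomain (rq C) (T k f - g) x ∈ V1 := by
    intro x
    have h1 := Ker_push V1 L (rq C) hCn _ hker x
    have h2 : h + T k f - T c h - g = (h - T c h) + (T k f - g) := by abel
    rwa [h2, Finsupp.mapDomain_add, mapDomain_sub', 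
      mapDomain_T_rq' c C (hcC (Subgroup.mem_zpowers c)), sub_self, zero_add] at h1
  -- pivot
  obtain ⟨j, hj⟩ : ∃ j, Finsupp.mapDomain π g j ≠ 0 := by
    by_contra! hh
    exact hg (Finsupp.ext hh)
  obtain ⟨t, ht, rfl⟩ := exists_of_mapDomain_ne _ _ _ hj
  have htE : t ∈ E := Or.inl ht
  have hgE : ∀ x ∈ g.support, x ∈ E := fun x hx => Or.inl hx
  have h3 : Finsupp.mapDomain (rq C) g (rq C t) ∉ V1 := by
    rw [cmp (rq C) π E hEE g hgE t htE]
    intro hh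
    exact hj (hV1 _ (Or.inl ⟨_, rfl⟩) hh)
  have h4 : Finsupp.mapDomain (rq C) (T k f) (rq C t) ≠ 0 := by
    intro hh
    have := hval (rq C t)
    rw [mapDomain_sub', Finsupp.sub_apply, hh, zero_sub] at this
    exact h3 (V1.neg_mem_iff.1 this)
  obtain ⟨x, hx, hxt⟩ := exists_of_mapDomain_ne _ _ _ h4
  obtain ⟨s, hs, rfl⟩ := T_support _ _ _ hx
  rw [rq_eq] at hxt
  obtain ⟨d, hd, l, hl, hdl⟩ := Subgroup.mem_sup_of_normal_right.1 hxt
  obtain ⟨u, hu⟩ : ∃ u, u = t * s⁻¹ := ⟨_, rfl⟩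
  have huU : u ∈ U := ⟨t, ht, s, hs, hu.symm⟩
  have hudl : u = d * (l * k) := by
    have : t = d * l * (k * s) := by rw [hdl]; group
    rw [hu, this]; group
  have hdc : Commute d c := by
    obtain ⟨i, rfl⟩ := Subgroup.mem_zpowers_iff.1 hd
    exact (Commute.refl c).zpow_left i
  have hub : u * b * u⁻¹ = c := by
    have h5 : u * b * u⁻¹ * c⁻¹ ∈ L := by
      have h6 : u * b * u⁻¹ * c⁻¹ = d * (l * ((k * b * k⁻¹ * c⁻¹) * (c * l⁻¹ * c⁻¹))) * d⁻¹ := by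
        rw [hudl]
        have : d⁻¹ * c⁻¹ = c⁻¹ * d⁻¹ := (hdc.inv_inv).eq
        simp only [mul_inv_rev, mul_assoc, this, inv_mul_cancel_left]
      rw [h6]
      exact hLn.conj_mem _ (L.mul_mem hl (L.mul_mem hk (hLn.conj_mem _ (L.inv_mem hl) c))) d
    have h7 := hL2 _ ⟨u, huU, rfl⟩ ((le_sup_right : L2 ≤ Subgroup.zpowers 1 ⊔ L2) (hLL2 h5))
    simp only [Subgroup.zpowers_one_eq_bot, Subgroup.mem_bot] at h7
    exact mul_inv_eq_one.1 h7
  have hlk : l * k = d⁻¹ * u := by rw [hudl]; group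
  have h8 : T (l * k) f - g ∈ Im V c := by
    rw [mem_Im_iff, ← hπ, mapDomain_sub', hlk, T_mul, hπ,
      mapDomain_T_rq' _ _ (Subgroup.inv_mem _ hd), ← hπ, ← mapDomain_sub']
    ext j
    by_contra hne
    obtain ⟨e, he, rfl⟩ := exists_of_mapDomain_ne _ _ _ hne
    have hsupp : ∀ x ∈ (T u f - g).support, x ∈ E := by
      intro x hx
      rcases Finset.mem_union.1 (Finsupp.support_sub hx) with hx | hx
      · obtain ⟨s, hs, rfl⟩ := T_support _ _ _ hx
        exact Or.inr ⟨u, huU, s, hs, rfl⟩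
      · exact Or.inl hx
    apply hne
    apply hV1 _ (Or.inr (Set.mem_biUnion huU ⟨_, rfl⟩))
    rw [← cmp (rq C) π E hEE _ hsupp e (hsupp e he)]
    have h9 := hval (rq C e)
    rw [mapDomain_sub', ← mapDomain_T_rq' (d * l) C (C.mul_mem (hcC hd) (hLC hl)), ← T_mul,
      mul_assoc, ← hudl, ← mapDomain_sub'] at h9
    exact h9
  refine ⟨l * k, ?_, ?_, h8⟩
  · have : l ∈ L0 := hl.1.1
    simpa using this
  · have : d⁻¹ * c = c * d⁻¹ := (hdc.inv_left).eq
    rw [hlk, mul_inv_rev, inv_inv]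
    calc d⁻¹ * u * b * (u⁻¹ * d) = d⁻¹ * (u * b * u⁻¹) * d := by group
      _ = c := by rw [hub, this]; group

end mod2
end WNil

namespace WNil

lemma orb_sum {X : Type*} [Group X] [Finite X] {V : Type*} [AddCommGroup V] (V0 : AddSubgroup V)
    (t : X) (D : X → V) (hD : ∀ j, D j - D (t⁻¹ * j) ∈ V0) :
    ∃ Y : X → V, ∀ j, D j - ∑ i ∈ Finset.range (orderOf t), Y ((t ^ i)⁻¹ * j) ∈ V0 := by
  classical
  let rep : X → X := fun j => (Quotient.mk (QuotientGroup.rightRel (Subgroup.zpowers t)) j).out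
  have hrep : ∀ j, j * (rep j)⁻¹ ∈ Subgroup.zpowers t := fun j =>
    QuotientGroup.rightRel_apply.1 (Quotient.mk_out (s := QuotientGroup.rightRel (Subgroup.zpowers t)) j)
  have hrep2 : ∀ i : ℕ, ∀ j, rep ((t ^ i)⁻¹ * j) = rep j := by
    intro i j
    have : (Quotient.mk (QuotientGroup.rightRel (Subgroup.zpowers t)) ((t ^ i)⁻¹ * j)) =
        Quotient.mk (QuotientGroup.rightRel (Subgroup.zpowers t)) j := by
      apply Quotient.sound
      apply QuotientGroup.rightRel_apply.2
      have : j * ((t ^ i)⁻¹ * j)⁻¹ = t ^ i := by group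
      rw [this]
      exact Subgroup.npow_mem_zpowers t i
    simp only [rep, this]
  have hDi : ∀ i : ℕ, ∀ j, D j - D ((t ^ i)⁻¹ * j) ∈ V0 := by
    intro i
    induction i with
    | zero => intro j; simp
    | succ i ih =>
      intro j
      have h1 := V0.add_mem (ih j) (hD ((t ^ i)⁻¹ * j))
      convert h1 using 1
      rw [pow_succ, mul_inv_rev, mul_assoc]
      abel
  refine ⟨fun j => if rep j = j then D j else 0, fun j => ?_⟩
  obtain ⟨i0, hi0, hi0'⟩ := Finset.mem_image.1 ((mem_zpowers_iff_mem_range_orderOf).1 (hrep j))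
  have hr : (t ^ i0)⁻¹ * j = rep j := by rw [hi0']; group
  rw [Finset.sum_eq_single i0]
  · beta_reduce
    rw [if_pos]
    · exact hDi i0 j
    · rw [hrep2, hr]
  · intro i hi hne
    beta_reduce
    rw [if_neg]
    intro h
    rw [hrep2] at h
    apply hne
    apply pow_injOn_Iio_orderOf (x := t) (by simpa using hi) (by simpa using hi0)
    simp only
    have := hr.trans h
    simpa using this.symm
  · exact fun h => absurd hi0 h

lemma sum_periodic {V : Type*} [AddCommGroup V] (u : ℕ → V) (a : ℕ) (hu : ∀ i, u (a + i) = u i)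
    (k : ℕ) : ∑ i ∈ Finset.range (a * k), u i = k • ∑ i ∈ Finset.range a, u i := by
  induction k with
  | zero => simp
  | succ k ih =>
    rw [mul_add, mul_one, add_comm, Finset.sum_range_add]
    simp only [hu]
    rw [ih, succ_nsmul, add_comm]

section mod4
variable {G : Type u} [Group G] {V : Type u} [AddCommGroup V]

lemma D1 (hnil : Group.IsNilpotent G) (hfg : Group.FG G) (c : G) (K : Subgroup G)
    (hKn : K.Normal) (hKf : K.FiniteIndex) (q : ℕ) (hq : 0 < q) :
    ∃ L : Subgroup G, L.Normal ∧ L.FiniteIndex ∧ L ≤ K ∧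
      ((∀ n : ℕ, c ^ n ∈ L → c ^ n = 1) ∨ (∀ n : ℕ, c ^ n ∈ L → q ∣ n)) := by
  by_cases hc : IsOfFinOrder c
  · obtain ⟨N, h1, h2, h3⟩ := sep_zpowers G hnil hfg 1 (Subgroup.zpowers c : Set G)
      (finite_zpowers.2 hc)
    refine ⟨K ⊓ N, inferInstance, inferInstance, inf_le_left, Or.inl fun n hn => ?_⟩
    have := h3 (c ^ n) (Subgroup.npow_mem_zpowers c n)
      ((le_sup_right : N ≤ Subgroup.zpowers 1 ⊔ N) hn.2)
    simpa using this
  · obtain ⟨N, h1, h2, h3⟩ := sep_zpowers G hnil hfg (c ^ q) ((fun j : ℕ => c ^ j) '' Set.Iio q)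
      ((Set.finite_Iio q).image _)
    refine ⟨K ⊓ N, inferInstance, inferInstance, inf_le_left, Or.inr fun n hn => ?_⟩
    have h4 : c ^ (n % q) ∈ Subgroup.zpowers (c ^ q) ⊔ N := by
      have h5 : c ^ (n % q) = ((c ^ q) ^ (n / q))⁻¹ * c ^ n := by
        conv_rhs => rw [← Nat.div_add_mod n q, pow_add, pow_mul]
        rw [Nat.div_add_mod n q]; group
      rw [h5]
      exact Subgroup.mul_mem_sup (Subgroup.inv_mem _ (Subgroup.npow_mem_zpowers _ _)) hn.2
    obtain ⟨z, hz⟩ := Subgroup.mem_zpowers_iff.1 (h3 _ ⟨n % q, Nat.mod_lt _ hq, rfl⟩ h4)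
    have hinj := injective_zpow_iff_not_isOfFinOrder.2 hc
    have h6 : (q : ℤ) * z = ((n % q : ℕ) : ℤ) := by
      apply hinj
      simp only [zpow_mul, zpow_natCast]
      exact hz
    have h7 : q ∣ n % q := by
      have : (q : ℤ) ∣ ((n % q : ℕ) : ℤ) := ⟨z, h6.symm⟩
      exact_mod_cast this
    exact (Nat.dvd_mod_iff (dvd_refl q)).1 h7

lemma T_pow (c : G) (V0 : AddSubgroup V) (L : Subgroup G) [L.Normal] (Y : G →₀ V) (s : Finset ℕ)
    (j : G ⧸ L) :
    Finsupp.mapDomain (fun g : G => (g : G ⧸ L)) (∑ i ∈ s, T (c ^ i) Y) j =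
      ∑ i ∈ s, Finsupp.mapDomain (fun g : G => (g : G ⧸ L)) Y (((c : G ⧸ L) ^ i)⁻¹ * j) := by
  have := map_sum (Finsupp.mapDomain.addMonoidHom (M := V) (fun g : G => (g : G ⧸ L)))
    (fun i => T (c ^ i) Y) s
  simp only [Finsupp.mapDomain.addMonoidHom_apply] at this
  rw [this, Finsupp.finsetSum_apply]
  refine Finset.sum_congr rfl fun i _ => ?_
  rw [mapDomain_T_mk]
  congr 1

lemma lemD (hnil : Group.IsNilpotent G) (hfg : Group.FG G) (c : G) (K : Subgroup G)
    (hKn : K.Normal) (hKf : K.FiniteIndex) (V0 : AddSubgroup V) (hV0 : V0.FiniteIndex) :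
    ∃ L : Subgroup G, L.Normal ∧ L.FiniteIndex ∧ L ≤ K ∧
      ∀ d : G →₀ V, d - T c d ∈ Ker V0 L → ∃ e, T c e = e ∧ d - e ∈ Ker V0 K := by
  haveI : Finite (G ⧸ K) := Subgroup.finite_quotient_of_finiteIndex
  obtain ⟨L, hn, hf, hle, hL⟩ := D1 hnil hfg c K hKn hKf (orderOf (c : G ⧸ K) * V0.index)
    (Nat.mul_pos (orderOf_pos _) (Nat.pos_of_ne_zero hV0.index_ne_zero))
  refine ⟨L, hn, hf, hle, fun d hd => ?_⟩
  haveI : Finite (G ⧸ L) := Subgroup.finite_quotient_of_finiteIndex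
  obtain ⟨Y0, hY0⟩ := orb_sum V0 (c : G ⧸ L)
    (Finsupp.mapDomain (fun g : G => (g : G ⧸ L)) d) (by
      intro j
      have := hd j
      rw [mapDomain_sub', Finsupp.sub_apply, mapDomain_T_mk] at this
      exact this)
  set n := orderOf (c : G ⧸ L) with hndef
  have hcn : c ^ n ∈ L := by
    rw [← QuotientGroup.eq_one_iff, QuotientGroup.mk_pow, hndef, pow_orderOf_eq_one]
  have hnpos : 0 < n := orderOf_pos _
  let Y : G →₀ V := Finsupp.mapDomain Quotient.out (Finsupp.equivFunOnFinite.symm Y0)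
  have hY : Finsupp.mapDomain (fun g : G => (g : G ⧸ L)) Y = Finsupp.equivFunOnFinite.symm Y0 := by
    simp only [Y]
    rw [← Finsupp.mapDomain_comp]
    conv_rhs => rw [← Finsupp.mapDomain_id (v := Finsupp.equivFunOnFinite.symm Y0)]
    congr 1
    funext j
    exact QuotientGroup.out_eq' j
  have h1 : d - ∑ i ∈ Finset.range n, T (c ^ i) Y ∈ Ker V0 L := by
    intro j
    rw [mapDomain_sub', Finsupp.sub_apply, T_pow c V0, hY]
    exact hY0 j
  rcases hL with hL | hL
  · refine ⟨∑ i ∈ Finset.range n, T (c ^ i) Y, ?_, Ker_mono _ _ _ _ le_rfl hle h1⟩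
    have h2 := hL n hcn
    rw [map_sum]
    simp only [← T_mul, ← pow_succ']
    have h3 := Finset.sum_range_succ (fun i => T (c ^ i) Y) n
    rw [Finset.sum_range_succ'] at h3
    simp only [h2, pow_zero] at h3
    exact add_right_cancel h3
  · refine ⟨0, by simp, ?_⟩
    have h2 : ∑ i ∈ Finset.range n, T (c ^ i) Y ∈ Ker V0 K := by
      intro j
      rw [T_pow c V0]
      obtain ⟨m, hm⟩ := hL n hcn
      rw [hm, mul_assoc, sum_periodic, mul_comm, mul_nsmul]
      · exact V0.nsmul_index_mem _
      · intro i
        rw [pow_add, pow_orderOf_eq_one, one_mul]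
    have := (Ker V0 K).add_mem (Ker_mono _ _ _ _ le_rfl hle h1) h2
    simpa using this

end mod4
end WNil

namespace WNil

lemma comap_fi {P Q : Type*} [Group P] [Group Q] (f : P →* Q) (H : Subgroup Q)
    (hf : H.FiniteIndex) : (H.comap f).FiniteIndex := by
  constructor
  rw [Subgroup.index_comap]
  exact Subgroup.FiniteIndex.index_ne_zero (H := H.subgroupOf f.range)

section wr
variable {G A : Type u} [Group G] [CommGroup A]

/-- base group to finitely supported functions -/
noncomputable def tau (f : WreathBase A G) : G →₀ Additive A :=
  Finsupp.ofSupportFinite (fun x => Additive.ofMul ((f : G → A) x)) f.2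

/-- left coordinate -/
noncomputable def lt (w : RWreath A G) : G →₀ Additive A := tau w.left

/-- pair constructor -/
noncomputable def mkW (m : G →₀ Additive A) (k : G) : RWreath A G :=
  ⟨⟨fun x => (m x).toMul, m.hasFiniteSupport⟩, k⟩

lemma lt_mkW (m : G →₀ Additive A) (k : G) : lt (mkW m k) = m := by
  ext x
  rfl

lemma right_mkW (m : G →₀ Additive A) (k : G) : (mkW m k).right = k := rfl

lemma ext_lt (w w' : RWreath A G) (h : lt w = lt w') (h' : w.right = w'.right) : w = w' := by
  apply SemidirectProduct.ext
  · apply Subtype.ext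
    funext x
    have := DFunLike.congr_fun h x
    exact Additive.ofMul.injective this
  · exact h'

lemma T_apply (c : G) (m : G →₀ Additive A) (x : G) : T c m x = m (c⁻¹ * x) := by
  simp only [T, Finsupp.mapDomain.addMonoidHom_apply]
  conv_lhs => rw [← mul_inv_cancel_left c x]
  exact Finsupp.mapDomain_apply (mul_right_injective c) _ _

lemma lt_mul (w w' : RWreath A G) : lt (w * w') = lt w + T w.right (lt w') := by
  ext x
  rw [Finsupp.add_apply, T_apply]
  rfl

lemma lt_one : lt (1 : RWreath A G) = 0 := by
  ext x
  rfl

lemma lt_inv (w : RWreath A G) : lt w⁻¹ = - T w.right⁻¹ (lt w) := by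
  have h := lt_mul w⁻¹ w
  rw [inv_mul_cancel, lt_one, SemidirectProduct.inv_right] at h
  exact eq_neg_of_add_eq_zero_left h.symm

/-- congruence subgroups -/
noncomputable def NN (V0 : AddSubgroup (Additive A)) (L : Subgroup G) [hL : L.Normal] :
    Subgroup (RWreath A G) where
  carrier := {w | w.right ∈ L ∧ lt w ∈ Ker V0 L}
  one_mem' := ⟨L.one_mem, by rw [lt_one]; exact zero_mem _⟩
  mul_mem' := by
    rintro a b ⟨h1, h2⟩ ⟨h3, h4⟩
    refine ⟨L.mul_mem h1 h3, ?_⟩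
    rw [lt_mul]
    exact add_mem h2 (T_mem_Ker _ _ _ _ h4)
  inv_mem' := by
    rintro a ⟨h1, h2⟩
    refine ⟨L.inv_mem h1, ?_⟩
    rw [lt_inv]
    exact neg_mem (T_mem_Ker _ _ _ _ h2)

lemma mem_NN (V0 : AddSubgroup (Additive A)) (L : Subgroup G) [hL : L.Normal] (w : RWreath A G) :
    w ∈ NN V0 L ↔ w.right ∈ L ∧ lt w ∈ Ker V0 L := Iff.rfl

lemma NN_normal (V0 : AddSubgroup (Additive A)) (L : Subgroup G) [hL : L.Normal] :
    (NN V0 L).Normal := by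
  constructor
  rintro n ⟨h1, h2⟩ w
  have h3 : w.right * n.right * w.right⁻¹ ∈ L := hL.conj_mem _ h1 _
  refine ⟨h3, ?_⟩
  rw [lt_mul, lt_mul, lt_inv, map_neg, ← T_mul, SemidirectProduct.mul_right]
  have h4 := T_sub_mem_Ker _ V0 L h3 (lt w)
  have h5 := T_mem_Ker w.right _ _ _ h2
  convert sub_mem h5 h4 using 1
  abel

lemma NN_fi (V0 : AddSubgroup (Additive A)) (hV0 : V0.FiniteIndex)
    (L : Subgroup G) [hL : L.Normal] (hLf : L.FiniteIndex) :
    (NN V0 L).FiniteIndex := by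
  haveI : Finite (G ⧸ L) := Subgroup.finite_quotient_of_finiteIndex
  haveI : Finite (Additive A ⧸ V0) := AddSubgroup.finite_quotient_of_finiteIndex
  rw [Subgroup.finiteIndex_iff_finite_quotient]
  let φ : RWreath A G → (G ⧸ L) × (G ⧸ L → Additive A ⧸ V0) := fun w =>
    ((w.right : G ⧸ L), fun j =>
      ((Finsupp.mapDomain (fun g : G => (g : G ⧸ L)) (lt w) j : Additive A) : Additive A ⧸ V0))
  have hφ : ∀ a b, φ a = φ b → (a : RWreath A G ⧸ NN V0 L) = b := by
    intro a b h
    rw [QuotientGroup.eq]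
    have h1 := congrArg Prod.fst h
    have h2 := congrArg Prod.snd h
    refine ⟨QuotientGroup.eq.1 h1, ?_⟩
    rw [lt_mul, lt_inv, SemidirectProduct.inv_right, neg_add_eq_sub, ← map_sub]
    apply T_mem_Ker
    intro j
    have h3 := QuotientAddGroup.eq.1 (congrFun h2 j)
    rw [mapDomain_sub', Finsupp.sub_apply]
    rwa [neg_add_eq_sub] at h3
  refine Finite.of_injective (fun q : RWreath A G ⧸ NN V0 L => φ q.out) ?_
  intro q q' h
  have := hφ _ _ h
  simpa using this

lemma contain (H0 : Subgroup (RWreath A G)) (hn : H0.Normal) (hf : H0.FiniteIndex) :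
    ∃ V0 : AddSubgroup (Additive A), V0.FiniteIndex ∧ ∃ K : Subgroup G, ∃ _ : K.Normal,
      K.FiniteIndex ∧ NN V0 K ≤ H0 := by
  let ψ : A →* RWreath A G :=
    { toFun := fun a => mkW (Finsupp.single 1 (Additive.ofMul a)) 1
      map_one' := by
        apply ext_lt
        · rw [lt_mkW, lt_one]; simp
        · rfl
      map_mul' := by
        intro a b
        apply ext_lt
        · rw [lt_mul, lt_mkW, lt_mkW, lt_mkW, right_mkW, T_one, ofMul_mul, Finsupp.single_add]
        · simp [right_mkW] }
  let V0 : AddSubgroup (Additive A) := Subgroup.toAddSubgroup (H0.comap ψ)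
  have hV0 : ∀ v : Additive A, v ∈ V0 → mkW (Finsupp.single 1 v) (1 : G) ∈ H0 := fun v hv => hv
  let K : Subgroup G := H0.comap SemidirectProduct.inr
  have hK : ∀ k, k ∈ K ↔ mkW (0 : G →₀ Additive A) k ∈ H0 := fun k => Iff.rfl
  let M0 : AddSubgroup (G →₀ Additive A) :=
    { carrier := {m | mkW m (1 : G) ∈ H0}
      zero_mem' := H0.one_mem
      add_mem' := by
        intro a b ha hb
        have := H0.mul_mem ha hb
        have h2 : mkW (a + b) (1 : G) = mkW a 1 * mkW b 1 := by
          apply ext_lt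
          · rw [lt_mul, lt_mkW, lt_mkW, lt_mkW, right_mkW, T_one]
          · simp [right_mkW]
        show mkW (a + b) (1 : G) ∈ H0
        rwa [h2]
      neg_mem' := by
        intro a ha
        have := H0.inv_mem ha
        have h2 : mkW (-a) (1 : G) = (mkW a 1)⁻¹ := by
          apply ext_lt
          · rw [lt_inv, lt_mkW, lt_mkW, right_mkW, inv_one, T_one]
          · simp [right_mkW]
        show mkW (-a) (1 : G) ∈ H0
        rwa [h2] }
  have hM0 : ∀ m, m ∈ M0 ↔ mkW m (1 : G) ∈ H0 := fun m => Iff.rfl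
  have hT : ∀ g m, m ∈ M0 → T g m ∈ M0 := by
    intro g m hm
    have := hn.conj_mem _ hm (mkW 0 g)
    rw [hM0]
    convert this using 1
    apply ext_lt
    · simp only [lt_mul, lt_mkW, right_mkW, lt_inv, map_neg, map_zero, neg_zero, zero_add, add_zero]
    · simp [right_mkW]
  have h1 : ∀ g v, v ∈ V0 → Finsupp.single g v ∈ M0 := by
    intro g v hv
    have := hT g _ (hV0 v hv)
    rwa [T_single, mul_one] at this
  have h2 : ∀ l ∈ K, ∀ m, T l m - m ∈ M0 := by
    intro l hl m
    rw [hK] at hl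
    have := H0.mul_mem hl (hn.conj_mem _ (H0.inv_mem hl) (mkW m 1))
    rw [hM0]
    convert this using 1
    apply ext_lt
    · simp [lt_mul, lt_mkW, right_mkW, lt_inv, ← T_mul, T_one, sub_eq_add_neg]
    · simp [right_mkW]
  have h3 : ∀ g, ∀ l ∈ K, ∀ v, Finsupp.single (g * l) v - Finsupp.single g v ∈ M0 := by
    intro g l hl v
    have := hT g _ (h2 l hl (Finsupp.single 1 v))
    rwa [map_sub, T_single, T_single, T_single, mul_one, mul_one] at this
  have h4 : ∀ m : G →₀ Additive A, Finsupp.mapDomain Quotient.out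
      (Finsupp.mapDomain (fun g : G => (g : G ⧸ K)) m) - m ∈ M0 := by
    intro m
    induction m using Finsupp.induction_linear with
    | zero => simp
    | add f g hf hg =>
      rw [Finsupp.mapDomain_add, Finsupp.mapDomain_add]
      convert add_mem hf hg using 1
      abel
    | single g v =>
      rw [Finsupp.mapDomain_single, Finsupp.mapDomain_single]
      obtain ⟨l, hl⟩ := QuotientGroup.mk_out_eq_mul K g
      rw [hl]
      exact h3 _ _ l.2 _
  refine ⟨V0, ?_, K, inferInstance, comap_fi _ H0 hf, ?_⟩
  · constructor
    rw [Subgroup.index_toAddSubgroup]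
    exact (comap_fi ψ H0 hf).index_ne_zero
  · intro w hw
    obtain ⟨hw1, hw2⟩ := (mem_NN _ _ _).1 hw
    have h5 : lt w ∈ M0 := by
      have h6 : Finsupp.mapDomain Quotient.out
          (Finsupp.mapDomain (fun g : G => (g : G ⧸ K)) (lt w)) ∈ M0 :=
        AddSubgroup.sum_mem _ fun j _ => h1 _ _ (hw2 j)
      have := sub_mem h6 (h4 (lt w))
      simpa using this
    have h7 := H0.mul_mem ((hM0 _).1 h5) ((hK _).1 hw1)
    convert h7 using 1
    apply ext_lt
    · simp [lt_mul, lt_mkW]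
    · simp [right_mkW]

lemma lemAB (hnil : Group.IsNilpotent G) (hfg : Group.FG G)
    (hV : ∀ v : Additive A, v ≠ 0 → ∃ N : AddSubgroup (Additive A), N.FiniteIndex ∧ v ∉ N)
    (b c : G) (f g : G →₀ Additive A)
    (hfgc : g ∉ Im (Additive A) c ∨ (f ∈ Im (Additive A) b ∧ g ∈ Im (Additive A) c))
    (L0 : Subgroup G) (hn : L0.Normal) (hf : L0.FiniteIndex)
    (V0 : AddSubgroup (Additive A)) (h0 : V0.FiniteIndex) :
    ∃ L : Subgroup G, L.Normal ∧ L.FiniteIndex ∧ L ≤ L0 ∧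
    ∃ V1 : AddSubgroup (Additive A), V1.FiniteIndex ∧ V1 ≤ V0 ∧
      ∀ k, ∀ h : G →₀ Additive A, k * b * k⁻¹ * c⁻¹ ∈ L → h + T k f - T c h - g ∈ Ker V1 L →
        ∃ k', k' * k⁻¹ ∈ L0 ∧ k' * b * k'⁻¹ = c ∧ T k' f - g ∈ Im (Additive A) c := by
  rcases hfgc with hg | ⟨h1, h2⟩
  · exact lemB hnil hfg hV b c f g (fun h => hg ((mem_Im_iff _ _).2 h)) L0 hn hf V0 h0
  · obtain ⟨L, h3, h4, h5, h6⟩ := lemA hnil hfg b c L0 hn hf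
    refine ⟨L, h3, h4, h5, V0, h0, le_rfl, fun k h hk _ => ?_⟩
    obtain ⟨k', hk', hk''⟩ := h6 k hk
    refine ⟨k', hk', hk'', sub_mem ?_ h2⟩
    obtain ⟨u, rfl⟩ := (mem_Im _ _).1 h1
    rw [mem_Im]
    refine ⟨T k' u, ?_⟩
    rw [map_sub, ← T_mul, ← T_mul, ← hk'']
    congr 3
    group

lemma core (hnil : Group.IsNilpotent G) (hfg : Group.FG G)
    (hV : ∀ v : Additive A, v ≠ 0 → ∃ N : AddSubgroup (Additive A), N.FiniteIndex ∧ v ∉ N)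
    (H : Subgroup (RWreath A G)) (hH : H.FiniteIndex) (x y : RWreath A G)
    (hxy : lt y ∉ Im (Additive A) y.right ∨
      (lt x ∈ Im (Additive A) x.right ∧ lt y ∈ Im (Additive A) y.right)) :
    ∃ N : Subgroup (RWreath A G), N.Normal ∧ N.FiniteIndex ∧
      ((∃ w ∈ H, w * x * w⁻¹ * y⁻¹ ∈ N) → ∃ w ∈ H, w * x * w⁻¹ = y) := by
  obtain ⟨V0, hV0, K, hK, hKf, hle⟩ := contain H.normalCore inferInstance inferInstance
  obtain ⟨L0, hL0n, hL0f, hL0K, hL0⟩ := lemD hnil hfg y.right K hK hKf V0 hV0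
  obtain ⟨L, hLn, hLf, hLle, V1, hV1f, hV1le, hL⟩ :=
    lemAB hnil hfg hV x.right y.right (lt x) (lt y) hxy L0 hL0n hL0f V0 hV0
  refine ⟨NN V1 L, NN_normal _ _, NN_fi _ hV1f _ hLf, ?_⟩
  rintro ⟨w, hwH, hw⟩
  obtain ⟨hw1, hw2⟩ := (mem_NN _ _ _).1 hw
  simp only [SemidirectProduct.mul_right, SemidirectProduct.inv_right] at hw1
  obtain ⟨f, hf⟩ : ∃ f, f = lt x := ⟨_, rfl⟩
  obtain ⟨g, hg⟩ : ∃ f, f = lt y := ⟨_, rfl⟩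
  obtain ⟨h, hh⟩ : ∃ f, f = lt w := ⟨_, rfl⟩
  obtain ⟨b, hb⟩ : ∃ f, f = x.right := ⟨_, rfl⟩
  obtain ⟨c, hc⟩ : ∃ f, f = y.right := ⟨_, rfl⟩
  obtain ⟨k, hk⟩ : ∃ f, f = w.right := ⟨_, rfl⟩
  rw [← hf, ← hg, ← hb, ← hc] at hL
  rw [← hc] at hL0
  rw [← hb, ← hc, ← hk] at hw1
  have hker : h + T k f - T c h - g ∈ Ker V1 L := by
    have e1 : lt (w * x * w⁻¹ * y⁻¹) = h + T k f - T (k * b * k⁻¹ * c⁻¹) (T c h)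
        - T (k * b * k⁻¹ * c⁻¹) g := by
      simp only [lt_mul, lt_inv, SemidirectProduct.mul_right, SemidirectProduct.inv_right, ← hf,
        ← hg, ← hh, ← hb, ← hc, ← hk, map_neg, ← T_mul, sub_eq_add_neg, inv_mul_cancel_right]
    rw [e1] at hw2
    have e2 := T_sub_mem_Ker _ V1 L hw1 (T c h)
    have e3 := T_sub_mem_Ker _ V1 L hw1 g
    convert add_mem hw2 (add_mem e2 e3) using 1
    abel
  obtain ⟨k', hk1, hk2, hk3⟩ := hL k h hw1 hker
  obtain ⟨h', hh'⟩ := (mem_Im _ _).1 (neg_mem hk3)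
  have hd : (h - h') - T c (h - h') ∈ Ker V0 L0 := by
    have e1 := Ker_mono _ _ _ _ hV1le hLle hker
    have e2 := T_sub_mem_Ker _ V0 L0 hk1 (T k f)
    rw [← T_mul, inv_mul_cancel_right] at e2
    convert add_mem e1 e2 using 1
    have : (h - h') - T c (h - h') = h - T c h - (h' - T c h') := by
      rw [map_sub]; abel
    rw [this, hh']
    abel
  obtain ⟨e, he1, he2⟩ := hL0 _ hd
  refine ⟨mkW (h' + e) k', ?_, ?_⟩
  · have hm : mkW (h' + e) k' * w⁻¹ ∈ NN V0 K := by
      rw [mem_NN]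
      have e0 : k' * k⁻¹ ∈ K := hL0K hk1
      refine ⟨?_, ?_⟩
      · simpa [right_mkW, ← hk] using e0
      · rw [lt_mul, lt_inv, lt_mkW, right_mkW, map_neg, ← T_mul, ← hk, ← hh]
        have e1 := T_sub_mem_Ker _ V0 K e0 h
        convert neg_mem (add_mem he2 e1) using 1
        abel
    have := H.mul_mem (H.normalCore_le (hle hm)) hwH
    simpa using this
  · apply ext_lt
    · simp only [lt_mul, lt_inv, lt_mkW, right_mkW, SemidirectProduct.mul_right, map_neg,
        ← T_mul, ← hf, ← hg, ← hb, hk2]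
      rw [map_add, he1]
      have : h' + e + T k' f + -(T c h' + e) = (h' - T c h') + T k' f := by abel
      rw [this, hh']
      abel
    · simpa [right_mkW, ← hb, ← hc] using hk2

lemma hcs (hnil : Group.IsNilpotent G) (hfg : Group.FG G) (hrf : IsResiduallyFinite A) :
    IsHereditarilyConjSeparable (RWreath A G) := by
  have hV : ∀ v : Additive A, v ≠ 0 → ∃ N : AddSubgroup (Additive A), N.FiniteIndex ∧ v ∉ N := by
    intro v hv
    obtain ⟨N, _, h2, h3⟩ := hrf v.toMul hv
    refine ⟨N.toAddSubgroup, ⟨?_⟩, h3⟩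
    rw [Subgroup.index_toAddSubgroup]
    exact h2.index_ne_zero
  intro H hH
  have key : ∀ x y : H, (lt y.1 ∉ Im (Additive A) y.1.right ∨
      (lt x.1 ∈ Im (Additive A) x.1.right ∧ lt y.1 ∈ Im (Additive A) y.1.right)) →
      ¬ IsConj x y → ∃ N : Subgroup H, ∃ hN : N.Normal, N.FiniteIndex ∧
    (haveI := hN; ¬ IsConj (QuotientGroup.mk x : H ⧸ N) (QuotientGroup.mk y)) := by
    intro x y hxy hne
    obtain ⟨N, h1, h2, h3⟩ := core hnil hfg hV H hH x.1 y.1 hxy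
    refine ⟨N.subgroupOf H, inferInstance, inferInstance, ?_⟩
    intro hc
    apply hne
    obtain ⟨w, hw⟩ := isConj_iff.1 hc
    obtain ⟨w, rfl⟩ := QuotientGroup.mk_surjective w
    rw [← QuotientGroup.mk_inv, ← QuotientGroup.mk_mul, ← QuotientGroup.mk_mul,
      ← div_eq_one, ← QuotientGroup.mk_div, QuotientGroup.eq_one_iff, div_eq_mul_inv] at hw
    obtain ⟨w', hw', hw2⟩ := h3 ⟨w.1, w.2, hw⟩
    exact isConj_iff.2 ⟨⟨w', hw'⟩, Subtype.ext hw2⟩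
  intro x y hne
  by_cases hy : lt y.1 ∈ Im (Additive A) y.1.right
  · by_cases hx : lt x.1 ∈ Im (Additive A) x.1.right
    · exact key x y (Or.inr ⟨hx, hy⟩) hne
    · obtain ⟨N, h1, h2, h3⟩ := key y x (Or.inl hx) (fun h => hne h.symm)
      exact ⟨N, h1, h2, fun h => h3 h.symm⟩
  · exact key x y (Or.inl hy) hne

end wr
end WNil

namespace WNil
section wr2
variable {G A : Type u} [Group G] [CommGroup A]

lemma comm_mem (N : Subgroup (RWreath A G)) (hn : N.Normal) (l : G)
    (hl : mkW (0 : G →₀ Additive A) l ∈ N) (m : G →₀ Additive A) : mkW (T l m - m) (1 : G) ∈ N := by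
  have := N.mul_mem hl (hn.conj_mem _ (N.inv_mem hl) (mkW m 1))
  convert this using 1
  apply ext_lt
  · simp [lt_mul, lt_mkW, right_mkW, lt_inv, ← T_mul, T_one, sub_eq_add_neg]
  · simp [right_mkW]

lemma not_pcs (t : G) (ht : ¬ IsOfFinOrder t) (a : A) (ha : a ≠ 1) (p : ℕ) (hp : p.Prime) :
    ¬ pConjSep p (RWreath A G) := by
  classical
  intro hsep
  obtain ⟨v, hv⟩ : ∃ v : Additive A, v = Additive.ofMul a := ⟨_, rfl⟩
  have hv0 : v ≠ 0 := by
    rw [hv]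
    exact fun h => ha (Additive.ofMul.injective h)
  set c := t ^ (p + 1) with hc
  have hnc : ¬ IsConj (mkW (0 : G →₀ Additive A) c)
      (mkW (Finsupp.single 1 v - Finsupp.single t v) c) := by
    intro h
    obtain ⟨w, hw⟩ := isConj_iff.1 h
    have h1 : w.right * c * w.right⁻¹ = c := congrArg SemidirectProduct.right hw
    have h2 := congrArg lt hw
    simp only [lt_mul, lt_inv, lt_mkW, right_mkW, SemidirectProduct.mul_right, map_neg,
        ← T_mul, map_zero, add_zero, h1] at h2
    have h3 : Finsupp.single 1 v - Finsupp.single t v ∈ Im (Additive A) c :=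
      (mem_Im _ _).2 ⟨lt w, by rw [sub_eq_add_neg]; exact h2⟩
    rw [mem_Im_iff, mapDomain_sub', Finsupp.mapDomain_single, Finsupp.mapDomain_single] at h3
    have h4 := DFunLike.congr_fun h3 (rq (Subgroup.zpowers c) 1)
    rw [Finsupp.sub_apply, Finsupp.single_eq_same, Finsupp.single_apply, if_neg] at h4
    · simp only [sub_zero, Finsupp.coe_zero, Pi.zero_apply] at h4
      exact hv0 h4
    · rw [rq_eq, one_mul, Subgroup.inv_mem_iff]
      intro h5
      obtain ⟨z, hz⟩ := Subgroup.mem_zpowers_iff.1 h5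
      have hinj := injective_zpow_iff_not_isOfFinOrder.2 ht
      have h6 : ((p + 1 : ℕ) : ℤ) * z = 1 := by
        apply hinj
        simp only [zpow_mul, zpow_natCast, zpow_one]
        exact hz
      have h7 : ((p + 1 : ℕ) : ℤ) ∣ 1 := ⟨z, h6.symm⟩
      have h8 : (p + 1) ∣ 1 := by exact_mod_cast h7
      have := Nat.le_of_dvd one_pos h8
      have := hp.two_le
      omega
  obtain ⟨N, ⟨hN, hfin, hpg⟩, hN', hcon⟩ := hsep _ _ hnc
  apply hcon
  let ι : G →* RWreath A G ⧸ N := (QuotientGroup.mk' N).comp SemidirectProduct.inr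
  have hι : ∀ g, ι g = QuotientGroup.mk (mkW (0 : G →₀ Additive A) g) := fun g => rfl
  obtain ⟨j, hj⟩ : ∃ j : ℕ, ι (c ^ j) = ι t := by
    obtain ⟨k, hk⟩ := hpg (ι t)
    have h1 : (p + 1).Coprime (orderOf (ι t)) := by
      refine Nat.Coprime.coprime_dvd_right (orderOf_dvd_of_pow_eq_one hk) ?_
      apply Nat.Coprime.pow_right
      simp
    obtain ⟨j, hj⟩ := exists_pow_eq_self_of_coprime h1
    refine ⟨j, ?_⟩
    rw [hc, map_pow, map_pow]
    exact hj
  have hl : mkW (0 : G →₀ Additive A) (c ^ j * t⁻¹) ∈ N := by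
    rw [← QuotientGroup.eq_one_iff, ← hι, map_mul, hj, ← map_mul, mul_inv_cancel, map_one]
  have hm := comm_mem N hN _ hl (Finsupp.single t v)
  rw [T_single, inv_mul_cancel_right] at hm
  obtain ⟨h, hh⟩ := (mem_Im _ _).1
    (single_mem_Im c 1 (c ^ j) (Subgroup.npow_mem_zpowers c j) v)
  rw [mul_one] at hh
  rw [isConj_iff]
  refine ⟨QuotientGroup.mk (mkW h 1), ?_⟩
  rw [← QuotientGroup.mk_inv, ← QuotientGroup.mk_mul, ← QuotientGroup.mk_mul, eq_comm,
      ← div_eq_one, ← QuotientGroup.mk_div, QuotientGroup.eq_one_iff, div_eq_mul_inv]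
  convert hm using 1
  apply ext_lt
  · have e : (mkW h 1 * mkW 0 c * (mkW h 1)⁻¹ : RWreath A G) =
        mkW (Finsupp.single 1 v - Finsupp.single (c ^ j) v) c := by
      apply ext_lt
      · rw [lt_mkW, ← hh]
        simp [lt_mul, lt_mkW, right_mkW, lt_inv, T_one, sub_eq_add_neg]
      · simp [right_mkW]
    rw [e, lt_mul, lt_inv, lt_mkW, lt_mkW, lt_mkW, right_mkW, right_mkW, map_neg, ← T_mul,
      mul_inv_cancel, T_one]
    abel
  · simp [right_mkW]

end wr2
end WNil

/-- If `G` is an infinite finitely generated nilpotent group and `A` is a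
nontrivial residually finite abelian group, then `A ≀ G` is hereditarily conjugacy
separable but not `p`-conjugacy separable for any prime `p`. -/
theorem wreath_nilpotent_hereditarily_conjSep (G A : Type u) [Group G] [Group A]
    [Infinite G] (hnil : Group.IsNilpotent G) (hfg : Group.FG G)
    [Nontrivial A] (hab : ∀ x y : A, x * y = y * x) (hrf : IsResiduallyFinite A) :
    IsHereditarilyConjSeparable (RWreath A G) ∧
      ∀ p : ℕ, p.Prime → ¬ pConjSep p (RWreath A G) := by
  letI : CommGroup A := { (inferInstance : Group A) with mul_comm := hab }
  refine ⟨WNil.hcs hnil hfg hrf, fun p hp => ?_⟩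
  obtain ⟨z, -, hz⟩ := WNil.exists_inforder_center G hnil hfg
  obtain ⟨a, ha⟩ := exists_ne (1 : A)
  exact WNil.not_pcs z hz a ha p hp
end

section
/- For every prime p, the lamplighter group (ℤ/pℤ) ≀ ℤ and the group ℤ ≀ ℤ are hereditarily conjugacy separable, but for every prime q neither of them is q-hereditarily conjugacy separable. -/
open Pointwise

universe u

section LampHelpers

open LaurentPolynomial

/-- Coordinates identifying `G` with `S[T;T⁻¹] ⋊ ℤ`. -/
structure LampData (S : Type) [CommRing S] (G : Type) [Group G] where
  L : G → LaurentPolynomial S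
  d : G → ℤ
  el : LaurentPolynomial S → ℤ → G
  L_mul : ∀ x y, L (x * y) = L x + T (d x) * L y
  d_mul : ∀ x y, d (x * y) = d x + d y
  L_el : ∀ r i, L (el r i) = r
  d_el : ∀ r i, d (el r i) = i
  el_eta : ∀ g, el (L g) (d g) = g

namespace LampData

variable {S : Type} [CommRing S] {G : Type} [Group G] (D : LampData S G)

lemma ext' {x y : G} (h1 : D.L x = D.L y) (h2 : D.d x = D.d y) : x = y := by
  rw [← D.el_eta x, ← D.el_eta y, h1, h2]

lemma d_one : D.d 1 = 0 := by
  have := D.d_mul 1 1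
  simp at this; exact this

lemma L_one : D.L 1 = 0 := by
  have := D.L_mul 1 1
  simp [D.d_one] at this; exact this

lemma d_inv (x : G) : D.d x⁻¹ = - D.d x := by
  have := D.d_mul x⁻¹ x
  rw [inv_mul_cancel, D.d_one] at this
  omega

lemma L_inv (x : G) : D.L x⁻¹ = - (T (- D.d x) * D.L x) := by
  have := D.L_mul x⁻¹ x
  rw [inv_mul_cancel, D.L_one, D.d_inv] at this
  linear_combination -this

lemma T_cancel (i : ℤ) : (T i : LaurentPolynomial S) * T (-i) = 1 := by
  rw [← T_add]; simp

lemma L_conj (h x : G) :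
    D.L (h * x * h⁻¹) = (1 - T (D.d x)) * D.L h + T (D.d h) * D.L x := by
  rw [D.L_mul, D.L_mul, D.L_inv, D.d_mul, T_add]
  linear_combination (-(T (D.d x)) * D.L h) * T_cancel (S := S) (D.d h)

lemma d_conj (h x : G) : D.d (h * x * h⁻¹) = D.d x := by
  rw [D.d_mul, D.d_mul, D.d_inv]; ring

lemma L_div (z y : G) (h : D.d z = D.d y) : D.L (z * y⁻¹) = D.L z - D.L y := by
  rw [D.L_mul, D.L_inv, h]
  linear_combination (- D.L y) * T_cancel (S := S) (D.d y)

lemma d_div (z y : G) : D.d (z * y⁻¹) = D.d z - D.d y := by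
  rw [D.d_mul, D.d_inv]; ring

lemma d_pow (x : G) (n : ℕ) : D.d (x ^ n) = n * D.d x := by
  induction n with
  | zero => simp [D.d_one]
  | succ n ih => rw [pow_succ, D.d_mul, ih]; push_cast; ring

lemma d_zpow (x : G) (n : ℤ) : D.d (x ^ n) = n * D.d x := by
  cases n with
  | ofNat n => simp [D.d_pow]
  | negSucc n => rw [zpow_negSucc, D.d_inv, D.d_pow]; rw [Int.negSucc_eq]; push_cast; ring

/-- exponents acting trivially modulo an ideal -/
def per (V : Ideal (LaurentPolynomial S)) : AddSubgroup ℤ where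
  carrier := {i | T i - 1 ∈ V}
  zero_mem' := by simp
  add_mem' := by
    intro a b ha hb
    simp only [Set.mem_ofPred_eq] at *
    have : (T (a + b) - 1 : LaurentPolynomial S) = T a * (T b - 1) + (T a - 1) := by
      rw [T_add]; ring
    rw [this]
    exact V.add_mem (V.mul_mem_left _ hb) ha
  neg_mem' := by
    intro a ha
    simp only [Set.mem_ofPred_eq] at *
    have : (T (-a) - 1 : LaurentPolynomial S) = - T (-a) * (T a - 1) := by
      linear_combination T_cancel (S := S) a
    rw [this]
    exact V.mul_mem_left _ ha

lemma mem_per {V : Ideal (LaurentPolynomial S)} {i : ℤ} : i ∈ per V ↔ T i - 1 ∈ V := Iff.rfl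

/-- congruence subgroup attached to an ideal -/
def NV (V : Ideal (LaurentPolynomial S)) : Subgroup G where
  carrier := {g | D.L g ∈ V ∧ D.d g ∈ per V}
  one_mem' := by simp [D.L_one, D.d_one, zero_mem]
  mul_mem' := by
    rintro a b ⟨h1, h2⟩ ⟨h3, h4⟩
    refine ⟨?_, ?_⟩
    · rw [D.L_mul]; exact V.add_mem h1 (V.mul_mem_left _ h3)
    · rw [D.d_mul]; exact add_mem h2 h4
  inv_mem' := by
    rintro a ⟨h1, h2⟩
    refine ⟨?_, ?_⟩
    · rw [D.L_inv]; exact V.neg_mem (V.mul_mem_left _ h1)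
    · rw [D.d_inv]; exact neg_mem h2

lemma mem_NV {V : Ideal (LaurentPolynomial S)} {g : G} :
    g ∈ D.NV V ↔ D.L g ∈ V ∧ D.d g ∈ per V := Iff.rfl

lemma NV_normal (V : Ideal (LaurentPolynomial S)) : (D.NV V).Normal := by
  constructor
  intro x hx h
  rw [mem_NV] at *
  rw [D.L_conj, D.d_conj]
  refine ⟨V.add_mem ?_ (V.mul_mem_left _ hx.1), hx.2⟩
  have : (1 - T (D.d x)) * D.L h = (- D.L h) * (T (D.d x) - 1) := by ring
  rw [this]
  exact V.mul_mem_left _ hx.2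

end LampData

lemma finiteIndex_of_map {G F : Type*} [Group G] [Finite F] (U : Subgroup G) (φ : G → F)
    (h : ∀ a b, φ a = φ b → a⁻¹ * b ∈ U) : U.FiniteIndex := by
  have : Finite (G ⧸ U) := by
    apply Finite.of_injective (fun c : G ⧸ U => φ c.out)
    intro a b hab
    have := h _ _ hab
    rw [← QuotientGroup.eq] at this
    simpa using this
  exact Subgroup.finiteIndex_of_finite_quotient

lemma LampData.NV_finiteIndex {S : Type} [CommRing S] {G : Type} [Group G] (D : LampData S G)
    (V : Ideal (LaurentPolynomial S)) [Finite (LaurentPolynomial S ⧸ V)] :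
    (D.NV V).FiniteIndex := by
  apply finiteIndex_of_map (F := (LaurentPolynomial S ⧸ V) × (LaurentPolynomial S ⧸ V)) _
    (fun g => (Ideal.Quotient.mk V (D.L g), Ideal.Quotient.mk V (T (D.d g))))
  intro a b hab
  simp only [Prod.mk.injEq, Ideal.Quotient.eq] at hab
  rw [D.mem_NV, D.L_mul, D.L_inv, D.d_mul, D.d_inv, mem_per, T_add]
  constructor
  · have : -(T (-D.d a) * D.L a) + T (-D.d a) * D.L b = (- T (-D.d a)) * (D.L a - D.L b) := by
      ring
    rw [this]; exact V.mul_mem_left _ hab.1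
  · have : (T (-D.d a) * T (D.d b) - 1 : LaurentPolynomial S) = (- T (-D.d a)) * (T (D.d a) - T (D.d b)) := by
      linear_combination T_cancel (S := S) (D.d a)
    rw [this]; exact V.mul_mem_left _ hab.2

/-- criterion for separating two elements of a subgroup -/
lemma sep_of_normal {G : Type} [Group G] (H : Subgroup G) (x y : H) (N : Subgroup G)
    (hN : N.Normal) (hf : N.FiniteIndex)
    (h : ∀ g ∈ H, g * x * g⁻¹ * (y : G)⁻¹ ∉ N) :
    ∃ N : Subgroup H, ∃ hN : N.Normal, N.FiniteIndex ∧
    (haveI := hN; ¬ IsConj (QuotientGroup.mk x : H ⧸ N) (QuotientGroup.mk y)) := by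
  refine ⟨N.subgroupOf H, inferInstance, inferInstance, ?_⟩
  intro hc
  rw [isConj_iff] at hc
  obtain ⟨c, hc⟩ := hc
  obtain ⟨g, rfl⟩ := QuotientGroup.mk_surjective c
  rw [← QuotientGroup.mk_inv, ← QuotientGroup.mk_mul, ← QuotientGroup.mk_mul] at hc
  have h2 := QuotientGroup.eq.1 hc.symm
  rw [Subgroup.mem_subgroupOf] at h2
  refine h g g.2 ?_
  have := hN.conj_mem _ h2 (y : G)
  simpa [mul_assoc] using this

namespace LampData

variable {S : Type} [CommRing S] {G : Type} [Group G] (D : LampData S G)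

/-- reduction to a separating ideal, equal degree case -/
lemma sep_of_ideal (H : Subgroup G) (x y : H) (hd : D.d x = D.d y)
    (V : Ideal (LaurentPolynomial S)) [Finite (LaurentPolynomial S ⧸ V)]
    (h : ∀ g ∈ H, (1 - T (D.d x)) * D.L g + T (D.d g) * D.L x - D.L y ∉ V) :
    ∃ N : Subgroup H, ∃ hN : N.Normal, N.FiniteIndex ∧
    (haveI := hN; ¬ IsConj (QuotientGroup.mk x : H ⧸ N) (QuotientGroup.mk y)) := by
  apply sep_of_normal H x y (D.NV V) (D.NV_normal V) (D.NV_finiteIndex V)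
  intro g hg hm
  apply h g hg
  have := (D.mem_NV.1 hm).1
  rwa [D.L_div _ _ (by rw [D.d_conj, hd]), D.L_conj] at this

lemma not_conj_ne (H : Subgroup G) (x y : H) (hd : D.d x = D.d y) (hc : ¬ IsConj x y)
    (g : G) (hg : g ∈ H) : (1 - T (D.d x)) * D.L g + T (D.d g) * D.L x - D.L y ≠ 0 := by
  intro h0
  apply hc
  rw [isConj_iff]
  refine ⟨⟨g, hg⟩, Subtype.ext ?_⟩
  apply D.ext'
  · simp only [Subgroup.coe_mul, Subgroup.coe_inv]
    rw [D.L_conj]; exact sub_eq_zero.1 h0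
  · simp only [Subgroup.coe_mul, Subgroup.coe_inv]
    rw [D.d_conj, hd]

/-- different degree case -/
lemma sep_of_d (H : Subgroup G) (x y : H) (hd : D.d x ≠ D.d y) :
    ∃ N : Subgroup H, ∃ hN : N.Normal, N.FiniteIndex ∧
    (haveI := hN; ¬ IsConj (QuotientGroup.mk x : H ⧸ N) (QuotientGroup.mk y)) := by
  let e : ℕ := (D.d x - D.d y).natAbs + 1
  have : NeZero e := ⟨by simp [e]⟩
  let φ : G →* Multiplicative (ZMod e) :=
    { toFun := fun g => Multiplicative.ofAdd ((D.d g : ℤ) : ZMod e)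
      map_one' := by simp [D.d_one]
      map_mul' := fun a b => by simp [D.d_mul] }
  have hφ : ∀ g, g ∈ φ.ker ↔ (e : ℤ) ∣ D.d g := by
    intro g
    rw [MonoidHom.mem_ker, ← ZMod.intCast_zmod_eq_zero_iff_dvd]
    rfl
  apply sep_of_normal H x y φ.ker inferInstance inferInstance
  intro g hg hm
  rw [hφ, D.d_div, D.d_conj] at hm
  have := Int.natAbs_dvd_natAbs.2 hm
  have h2 := Nat.le_of_dvd (Int.natAbs_pos.2 (sub_ne_zero.2 hd)) this
  rw [Int.natAbs_natCast] at h2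
  exact absurd h2 (by simp [e])

end LampData
end LampHelpers

section LampHelpers2
open LaurentPolynomial

/-- reduction map `S[ℤ] → S'[ℤ/N]` -/
noncomputable def redHom {S S' : Type} [CommRing S] [CommRing S'] (ψ : S →+* S') (N : ℕ) :
    LaurentPolynomial S →+* AddMonoidAlgebra S' (ZMod N) :=
  (AddMonoidAlgebra.mapRingHom (ZMod N) ψ).comp
    (AddMonoidAlgebra.mapDomainRingHom S (Int.castAddHom (ZMod N)))

lemma redHom_T {S S' : Type} [CommRing S] [CommRing S'] (ψ : S →+* S') (N : ℕ) (i : ℤ) :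
    redHom ψ N (T i) = AddMonoidAlgebra.single (i : ZMod N) 1 := by
  have : (T i : LaurentPolynomial S) = AddMonoidAlgebra.single i 1 := rfl
  rw [this, redHom, RingHom.comp_apply, AddMonoidAlgebra.mapDomainRingHom_apply,
    AddMonoidAlgebra.mapDomain_single, AddMonoidAlgebra.mapRingHom_single]
  simp

lemma redHom_coeff {S S' : Type} [CommRing S] [CommRing S'] (ψ : S →+* S') (N : ℕ)
    (e : LaurentPolynomial S) (z : ZMod N) :
    (redHom ψ N e).coeff z = ψ (Finsupp.mapDomain (fun i : ℤ => (i : ZMod N)) e.coeff z) := by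
  simp [redHom, AddMonoidAlgebra.mapDomain]

lemma redHom_window {S S' : Type} [CommRing S] [CommRing S'] (ψ : S →+* S') (N : ℕ)
    (e : LaurentPolynomial S) (B : ℕ) (hB : ∀ i ∈ e.coeff.support, i.natAbs ≤ B) (hN : 2 * B < N)
    (i : ℤ) (hi : i ∈ e.coeff.support) :
    (redHom ψ N e).coeff (i : ZMod N) = ψ (e.coeff i) := by
  rw [redHom_coeff]
  congr 1
  apply Finsupp.mapDomain_apply' (e.coeff.support : Set ℤ) _ le_rfl ?_ hi
  intro a ha b hb hab
  have h1 := hB a ha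
  have h2 := hB b hb
  have h3 := (ZMod.intCast_eq_intCast_iff_dvd_sub a b N).1 hab
  obtain ⟨c, hc⟩ := h3
  have : c = 0 := by
    by_contra h0
    have : (N : ℤ) ≤ |b - a| := by
      rw [hc, abs_mul]
      have := Int.one_le_abs h0
      simp
      nlinarith
    have h5 : |b - a| ≤ 2 * B := by
      rw [abs_le]; omega
    omega
  subst this
  omega

lemma redHom_support {S S' : Type} [CommRing S] [CommRing S'] (ψ : S →+* S') (N : ℕ)
    (e : LaurentPolynomial S) (z : ZMod N) (hz : (redHom ψ N e).coeff z ≠ 0) :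
    ∃ i ∈ e.coeff.support, (i : ZMod N) = z := by
  classical
  rw [redHom_coeff] at hz
  have h1 : Finsupp.mapDomain (fun i : ℤ => (i : ZMod N)) e.coeff z ≠ 0 := by
    intro h; rw [h] at hz; simp at hz
  have h2 := Finsupp.mapDomain_support (Finsupp.mem_support_iff.2 h1)
  simpa using h2

lemma redHom_shift {S S' : Type} [CommRing S] [CommRing S'] (ψ : S →+* S') (N : ℕ)
    (e : LaurentPolynomial S) (j : ℤ) (z : ZMod N) :
    (redHom ψ N (T j * e)).coeff (j + z) = (redHom ψ N e).coeff z := by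
  rw [map_mul, redHom_T]
  simp [AddMonoidAlgebra.coeff_single_mul_apply]

/-- finite sets of nonzero scalars survive in some finite quotient -/
def ResFin (S : Type) [CommRing S] : Prop :=
  ∀ F : Finset S, 0 ∉ F → ∃ (S' : Type) (_ : CommRing S') (_ : Finite S') (ψ : S →+* S'),
    ∀ s ∈ F, ψ s ≠ 0

lemma exists_window {S : Type} [CommRing S] (hS : ResFin S) (E : Finset (LaurentPolynomial S)) :
    ∃ (B : ℕ) (S' : Type) (_ : CommRing S') (_ : Finite S') (ψ : S →+* S'),
      ∀ N : ℕ, 2 * B < N → ∀ e ∈ E, ∀ i ∈ e.coeff.support,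
        (redHom ψ N e).coeff (i : ZMod N) ≠ 0 := by
  classical
  obtain ⟨S', i1, i2, ψ, hψ⟩ := hS (E.biUnion fun e => e.coeff.support.image e.coeff) (by
    simp)
  refine ⟨E.sup fun e => e.coeff.support.sup Int.natAbs, S', i1, i2, ψ, ?_⟩
  intro N hN e he i hi
  rw [redHom_window ψ N e _ _ hN i hi]
  · apply hψ
    simp only [Finset.mem_biUnion, Finset.mem_image]
    exact ⟨e, he, i, hi, rfl⟩
  · intro i hi
    exact (Finset.le_sup (f := Int.natAbs) hi).trans
      (Finset.le_sup (f := fun e : LaurentPolynomial S => e.coeff.support.sup Int.natAbs) he)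

lemma finite_addMonoidAlgebra (S' : Type) [CommRing S'] [Finite S'] (N : ℕ) [NeZero N] :
    Finite (AddMonoidAlgebra S' (ZMod N)) :=
  Finite.of_injective (fun e => (e.coeff : ZMod N → S'))
    (DFunLike.coe_injective.comp AddMonoidAlgebra.coeff_injective)

namespace LampData

variable {S : Type} [CommRing S] {G : Type} [Group G] (D : LampData S G)

lemma sep_zero (hS : ResFin S) (H : Subgroup G) (hH : H.FiniteIndex) (x y : H)
    (hx : D.d x = 0) (hy : D.d y = 0) (hc : ¬ IsConj x y) :
    ∃ N : Subgroup H, ∃ hN : N.Normal, N.FiniteIndex ∧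
    (haveI := hN; ¬ IsConj (QuotientGroup.mk x : H ⧸ N) (QuotientGroup.mk y)) := by
  classical
  have hne := D.not_conj_ne H x y (by rw [hx, hy]) hc
  simp only [hx, T_zero, sub_self, zero_mul, zero_add] at hne
  obtain ⟨m, hm0, -, hm⟩ := Subgroup.exists_pow_mem_of_index_ne_zero hH.index_ne_zero (D.el 0 1)
  set f := D.L x
  set g := D.L y
  let E : Finset (LaurentPolynomial S) := {f, g} ∪
    (f.coeff.support ×ˢ g.coeff.support).image (fun q => T (q.2 - q.1) * f - g)
  obtain ⟨B, S', i1, i2, ψ, hψ⟩ := exists_window hS E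
  let N := m * (2 * B + 1)
  have hN : 2 * B < N := by
    have : 1 * (2 * B + 1) ≤ m * (2 * B + 1) := Nat.mul_le_mul_right _ hm0
    simp only [N]; omega
  have : NeZero N := ⟨by omega⟩
  have := finite_addMonoidAlgebra S' N
  have hE : ∀ e ∈ E, redHom ψ N e = 0 → e = 0 := by
    intro e he h0
    by_contra hne
    have : e.coeff.support.Nonempty := by
      rw [Finsupp.support_nonempty_iff]; simpa using hne
    obtain ⟨i, hi⟩ := this
    exact hψ N hN e he i hi (by rw [h0]; simp)
  have : Finite (LaurentPolynomial S ⧸ RingHom.ker (redHom ψ N)) :=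
    Finite.of_injective _ (RingHom.kerLift_injective (redHom ψ N))
  apply D.sep_of_ideal H x y (by rw [hx, hy]) (RingHom.ker (redHom ψ N))
  intro h hh hker
  simp only [hx, T_zero, sub_self, zero_mul, zero_add] at hker
  rw [RingHom.mem_ker, map_sub, sub_eq_zero] at hker
  change redHom ψ N (T (D.d h) * f) = redHom ψ N g at hker
  by_cases hf : f = 0
  · apply hne h hh
    rw [hf] at hker ⊢
    have := hE g (by simp [E]) (by rw [← hker]; simp)
    rw [this]; simp
  · have : f.coeff.support.Nonempty := by
      rw [Finsupp.support_nonempty_iff]; simpa using hf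
    obtain ⟨i0, hi0⟩ := this
    have h1 := hψ N hN f (by simp [E]) i0 hi0
    rw [← redHom_shift ψ N f (D.d h), hker] at h1
    obtain ⟨j0, hj0, hj⟩ := redHom_support ψ N g _ h1
    have h2 : ((D.d h : ℤ) : ZMod N) = ((j0 - i0 : ℤ) : ZMod N) := by
      push_cast; rw [hj]; ring
    obtain ⟨c, hc⟩ := (ZMod.intCast_eq_intCast_iff_dvd_sub _ _ N).1 h2
    let h' := h * ((D.el 0 1) ^ m) ^ ((2 * B + 1 : ℕ) * c : ℤ)
    have hh' : h' ∈ H := H.mul_mem hh (H.zpow_mem hm _)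
    have hdh : D.d h' = j0 - i0 := by
      simp only [h']
      rw [D.d_mul, D.d_zpow, D.d_pow, D.d_el]
      have : (N : ℤ) = m * (2 * B + 1 : ℕ) := by simp [N]
      rw [this] at hc
      linear_combination - hc
    apply hne h' hh'
    rw [hdh]
    apply hE
    · apply Finset.mem_union_right
      exact Finset.mem_image.2 ⟨(i0, j0), Finset.mem_product.2 ⟨hi0, hj0⟩, rfl⟩
    · rw [map_sub, map_mul, redHom_T, ← h2, ← redHom_T ψ N (D.d h), ← map_mul, hker, sub_self]

end LampData
end LampHelpers2

section LampHelpers3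
open LaurentPolynomial

/-- finitely generated abelian groups are residually finite -/
lemma exists_not_divisible {Q : Type} [AddCommGroup Q] [Module.Finite ℤ Q] (b : Q) (hb : b ≠ 0) :
    ∃ n : ℕ, 0 < n ∧ ∀ q : Q, b ≠ n • q := by
  have hN : IsNoetherian ℤ Q := inferInstance
  obtain ⟨P, hP, hmax⟩ := set_has_maximal_iff_noetherian.2 hN {P : Submodule ℤ Q | b ∉ P}
    ⟨⊥, by simpa using hb⟩
  have key : ∀ z : Q, z ∉ P → b ∈ P ⊔ Submodule.span ℤ {z} := by
    intro z hz
    by_contra hc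
    refine hmax (P ⊔ Submodule.span ℤ {z}) hc (lt_of_le_of_ne le_sup_left ?_)
    intro h
    apply hz
    rw [h]
    exact Submodule.mem_sup_right (Submodule.mem_span_singleton_self z)
  have key2 : ∀ z : Q, z ∉ P → ∃ a : ℤ, b - a • z ∈ P := by
    intro z hz
    obtain ⟨u, hu, v, hv, huv⟩ := Submodule.mem_sup.1 (key z hz)
    obtain ⟨a, rfl⟩ := Submodule.mem_span_singleton.1 hv
    exact ⟨a, by rw [← huv]; simpa using hu⟩
  have tors : ∀ z : Q, ∃ a : ℤ, a ≠ 0 ∧ a • z ∈ P := by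
    intro z
    by_cases hz : z ∈ P
    · exact ⟨1, one_ne_zero, by simpa using hz⟩
    obtain ⟨a, ha⟩ := key2 z hz
    have ha0 : a ≠ 0 := by
      rintro rfl
      apply hP; simpa using ha
    by_cases h2 : (2 * a) • z ∈ P
    · exact ⟨2 * a, by omega, h2⟩
    obtain ⟨c, hc⟩ := key2 _ h2
    refine ⟨a - c * (2 * a), ?_, ?_⟩
    · intro h0
      have : a * (1 - 2 * c) = 0 := by linear_combination h0
      rcases mul_eq_zero.1 this with h | h <;> omega
    · have := P.sub_mem hc ha
      convert this using 1
      module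
  have : Finite (Q ⧸ P) := by
    apply Module.finite_of_fg_torsion
    intro z
    obtain ⟨z, rfl⟩ := Submodule.Quotient.mk_surjective P z
    obtain ⟨a, ha, h⟩ := tors z
    refine ⟨⟨a, mem_nonZeroDivisors_of_ne_zero ha⟩, ?_⟩
    exact (Submodule.Quotient.mk_eq_zero P).2 h
  refine ⟨Nat.card (Q ⧸ P), Nat.card_pos, ?_⟩
  rintro q rfl
  apply hP
  rw [← Submodule.Quotient.mk_eq_zero P, Submodule.Quotient.mk_smul]
  exact card_nsmul_eq_zero'

/-- a finite set of nonzero elements avoids `nQ` for some `n` -/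
lemma exists_not_divisible_finite {Q : Type} [AddCommGroup Q] [Module.Finite ℤ Q] (B : Set Q)
    (hB : B.Finite) : ∃ n : ℕ, 0 < n ∧ ∀ b ∈ B, b ≠ 0 → ∀ q : Q, b ≠ n • q := by
  induction B, hB using Set.Finite.induction_on with
  | empty => exact ⟨1, one_pos, by simp⟩
  | @insert a s _ _ ih =>
    obtain ⟨n, hn, h⟩ := ih
    by_cases ha : a = 0
    · refine ⟨n, hn, ?_⟩
      rintro b (rfl | hb) hb0
      · exact absurd ha hb0
      · exact h b hb hb0
    · obtain ⟨m, hm, h'⟩ := exists_not_divisible a ha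
      refine ⟨m * n, Nat.mul_pos hm hn, ?_⟩
      rintro b (rfl | hb) hb0 q
      · rw [mul_smul]; exact h' _
      · rw [mul_comm, mul_smul]; exact h b hb hb0 _

variable {S : Type} [CommRing S]

lemma T_mod (k i : ℤ) :
    ∃ e : LaurentPolynomial S, T i = T (i % k) + (1 - T k) * e := by
  have h1 : k ∈ LampData.per (Ideal.span {(1 - T k : LaurentPolynomial S)}) := by
    have h : (T k - 1 : LaurentPolynomial S) = -(1 - T k) := by ring
    rw [LampData.mem_per, h]
    exact neg_mem (Ideal.mem_span_singleton_self _)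
  have h2 := zsmul_mem h1 (i / k)
  rw [LampData.mem_per] at h2
  obtain ⟨e, he⟩ := Ideal.mem_span_singleton'.1 h2
  refine ⟨T (i % k) * e, ?_⟩
  have h3 : (T i : LaurentPolynomial S) = T (i % k) * T ((i / k) • k) := by
    rw [← T_add]; congr 1
    rw [smul_eq_mul, mul_comm]; exact (Int.emod_add_mul_ediv i k).symm
  rw [h3]
  linear_combination - T (i % k) * he

lemma finite_quot (hS : Function.Surjective (Int.cast : ℤ → S)) (k : ℤ) (hk : k ≠ 0)
    (I : Ideal (LaurentPolynomial S)) [Finite (LaurentPolynomial S ⧸ I)] :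
    Module.Finite ℤ (LaurentPolynomial S ⧸ (Ideal.span {(1 - T k : LaurentPolynomial S)} * I)) := by
  set J := Ideal.span {(1 - T k : LaurentPolynomial S)} * I
  let π := Ideal.Quotient.mk J
  let X : Set (LaurentPolynomial S ⧸ J) :=
    (fun i : ℤ => π (T i)) '' (Set.Ico 0 |k|) ∪
      Set.range (fun ρ : LaurentPolynomial S ⧸ I => π ((1 - T k) * ρ.out))
  have hX : X.Finite := ((Set.finite_Ico _ _).image _).union (Set.finite_range _)
  refine ⟨⟨hX.toFinset, ?_⟩⟩
  rw [Set.Finite.coe_toFinset, eq_top_iff]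
  have step1 : ∀ e, π ((1 - T k) * e) ∈ Submodule.span ℤ X := by
    intro e
    have h : π ((1 - T k) * e) =
        π ((1 - T k) * (Quotient.out (Ideal.Quotient.mk I e) : LaurentPolynomial S)) := by
      apply Ideal.Quotient.eq.2
      rw [← mul_sub]
      apply Ideal.mul_mem_mul (Ideal.mem_span_singleton_self _)
      rw [← Ideal.Quotient.eq]
      exact (Ideal.Quotient.mk_out _).symm
    rw [h]
    exact Submodule.subset_span (Or.inr ⟨_, rfl⟩)
  have step2 : ∀ i : ℤ, π (T i) ∈ Submodule.span ℤ X := by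
    intro i
    obtain ⟨e, he⟩ := T_mod (S := S) k i
    rw [he, map_add]
    refine add_mem (Submodule.subset_span (Or.inl ⟨_, ?_, rfl⟩)) (step1 e)
    exact ⟨Int.emod_nonneg _ hk, Int.emod_lt_abs _ hk⟩
  rintro q -
  obtain ⟨r, rfl⟩ := Ideal.Quotient.mk_surjective q
  induction r using LaurentPolynomial.induction_on' with
  | add p q hp hq => rw [map_add]; exact add_mem hp hq
  | C_mul_T n a =>
    obtain ⟨a, rfl⟩ := hS a
    have : (C (a : S) * T n : LaurentPolynomial S) = a • T n := by simp
    rw [this, map_zsmul]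
    exact Submodule.smul_mem _ _ (step2 n)

namespace LampData

variable {G : Type} [Group G] (D : LampData S G)

lemma sep_ne (hS : Function.Surjective (Int.cast : ℤ → S)) (H : Subgroup G)
    (hH : H.FiniteIndex) (x y : H)
    (hd : D.d x = D.d y) (hk : D.d x ≠ 0) (hc : ¬ IsConj x y) :
    ∃ N : Subgroup H, ∃ hN : N.Normal, N.FiniteIndex ∧
    (haveI := hN; ¬ IsConj (QuotientGroup.mk x : H ⧸ N) (QuotientGroup.mk y)) := by
  have hne := D.not_conj_ne H x y hd hc
  have hel : ∀ r s, D.el (r + s) 0 = D.el r 0 * D.el s 0 := by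
    intro r s
    apply D.ext'
    · rw [D.L_mul, D.L_el, D.L_el, D.L_el, D.d_el]; simp
    · rw [D.d_mul, D.d_el, D.d_el, D.d_el]; simp
  have hel0 : D.el 0 0 = 1 := by
    apply D.ext'
    · rw [D.L_el, D.L_one]
    · rw [D.d_el, D.d_one]
  -- the ideal
  let IA : AddSubgroup (LaurentPolynomial S) :=
    { carrier := {r | D.el r 0 ∈ H.normalCore}
      zero_mem' := by
        simp only [Set.mem_ofPred_eq]; rw [hel0]; exact one_mem _
      add_mem' := by
        intro a b ha hb
        simp only [Set.mem_ofPred_eq] at *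
        rw [hel]; exact mul_mem ha hb
      neg_mem' := by
        intro a ha
        simp only [Set.mem_ofPred_eq] at *
        have h1 : D.el (-a) 0 = (D.el a 0)⁻¹ := by
          rw [eq_inv_iff_mul_eq_one, ← hel, neg_add_cancel, hel0]
        rw [h1]; exact inv_mem ha }
  have hIA : ∀ r, r ∈ IA ↔ D.el r 0 ∈ H.normalCore := fun r => Iff.rfl
  have hT : ∀ (i : ℤ) r, r ∈ IA → T i * r ∈ IA := by
    intro i r hr
    rw [hIA] at *
    have := (Subgroup.normalCore_normal H).conj_mem _ hr (D.el 0 i)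
    convert this using 1
    apply D.ext'
    · rw [D.L_conj, D.L_el, D.L_el, D.L_el, D.d_el, D.d_el]; simp
    · rw [D.d_conj, D.d_el, D.d_el]
  let I : Ideal (LaurentPolynomial S) :=
    { IA with
      smul_mem' := by
        intro c r hr
        change c * r ∈ IA
        induction c using LaurentPolynomial.induction_on' with
        | add p q hp hq => rw [add_mul]; exact add_mem hp hq
        | C_mul_T n a =>
          obtain ⟨a, rfl⟩ := hS a
          have : (C (a : S) * T n : LaurentPolynomial S) * r = a • (T n * r) := by
            simp [mul_assoc]
          rw [this]
          exact zsmul_mem (hT n r hr) _ }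
  have hI : ∀ r, r ∈ I ↔ D.el r 0 ∈ H.normalCore := fun r => Iff.rfl
  have hfin : Finite (LaurentPolynomial S ⧸ I) := by
    have : Finite (G ⧸ H.normalCore) := Subgroup.finite_quotient_of_finiteIndex
    apply Finite.of_injective
      (fun c : LaurentPolynomial S ⧸ I => (QuotientGroup.mk (D.el c.out 0) : G ⧸ H.normalCore))
    intro a b hab
    have h1 := QuotientGroup.eq.1 hab
    have h2 : (D.el a.out 0)⁻¹ * D.el b.out 0 = D.el (b.out - a.out) 0 := by
      rw [inv_mul_eq_iff_eq_mul, ← hel]; simp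
    rw [h2, ← hI, ← Ideal.Quotient.eq] at h1
    rw [← Ideal.Quotient.mk_out a, ← Ideal.Quotient.mk_out b]
    exact h1.symm
  set k := D.d x with hkdef
  let J := Ideal.span {(1 - T k : LaurentPolynomial S)} * I
  have hQ : Module.Finite ℤ (LaurentPolynomial S ⧸ J) := finite_quot hS k hk I
  let π := Ideal.Quotient.mk J
  let c : LaurentPolynomial S → ℤ → LaurentPolynomial S :=
    fun r i => (1 - T k) * r + T i * D.L x - D.L y
  let B : Set (LaurentPolynomial S ⧸ J) :=
    (fun q : (LaurentPolynomial S ⧸ I) × ℤ => π (c q.1.out q.2)) ''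
      (Set.univ ×ˢ Set.Ico 0 |k|)
  have hB : B.Finite := (Set.finite_univ.prod (Set.finite_Ico _ _)).image _
  obtain ⟨n, hn, hdiv⟩ := exists_not_divisible_finite B hB
  -- claim 1
  have claim1 : ∀ h ∈ H, π (c (D.L h) (D.d h)) ≠ 0 := by
    intro h hh h0
    rw [Ideal.Quotient.eq_zero_iff_mem] at h0
    obtain ⟨r, hr, hr2⟩ := Ideal.mem_span_singleton_mul.1 h0
    have h1 : D.el (-r) 0 * h ∈ H :=
      H.mul_mem (H.normalCore_le ((hI _).1 (I.neg_mem hr))) hh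
    apply hne _ h1
    rw [D.L_mul, D.d_mul, D.L_el, D.d_el, T_zero, zero_add]
    simp only [c] at hr2
    linear_combination -hr2
  -- claim 2
  have claim2 : ∀ h ∈ H, π (c (D.L h) (D.d h)) ∈ B := by
    intro h hh
    let h' := h * (x : G) ^ (-(D.d h / k))
    have hh' : h' ∈ H := H.mul_mem hh (H.zpow_mem x.2 _)
    have hconj : h' * x * h'⁻¹ = h * x * h⁻¹ := by
      simp only [h']; group
    have hcc : c (D.L h) (D.d h) = c (D.L h') (D.d h') := by
      simp only [c]
      rw [hkdef, ← D.L_conj, ← D.L_conj, hconj]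
    have hdh : D.d h' = D.d h % k := by
      simp only [h']
      rw [D.d_mul, D.d_zpow, ← hkdef]
      have := Int.emod_add_mul_ediv (D.d h) k
      linear_combination -this
    rw [hcc]
    refine ⟨(Ideal.Quotient.mk I (D.L h'), D.d h'), ⟨Set.mem_univ _, ?_⟩, ?_⟩
    · rw [hdh]
      exact ⟨Int.emod_nonneg _ hk, Int.emod_lt_abs _ hk⟩
    · apply Ideal.Quotient.eq.2
      have : c (Quotient.out (Ideal.Quotient.mk I (D.L h'))) (D.d h') - c (D.L h') (D.d h') =
          (1 - T k) * (Quotient.out (Ideal.Quotient.mk I (D.L h')) - D.L h') := by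
        simp only [c]; ring
      change c (Quotient.out (Ideal.Quotient.mk I (D.L h'))) (D.d h') - c (D.L h') (D.d h') ∈ J
      rw [this]
      apply Ideal.mul_mem_mul (Ideal.mem_span_singleton_self _)
      rw [← Ideal.Quotient.eq]
      exact Ideal.Quotient.mk_out _
  let V : Ideal (LaurentPolynomial S) := J ⊔ Ideal.span {(n : LaurentPolynomial S)}
  have hJV : J ≤ V := le_sup_left
  have hVfin : Finite (LaurentPolynomial S ⧸ V) := by
    have : Module.Finite ℤ (LaurentPolynomial S ⧸ V) :=
      Module.Finite.of_surjective (Ideal.Quotient.factor hJV).toAddMonoidHom.toIntLinearMap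
        (Ideal.Quotient.factor_surjective hJV)
    apply Module.finite_of_fg_torsion
    intro z
    refine ⟨⟨n, mem_nonZeroDivisors_of_ne_zero (by exact_mod_cast hn.ne')⟩, ?_⟩
    obtain ⟨z, rfl⟩ := Ideal.Quotient.mk_surjective z
    change (n : ℤ) • Ideal.Quotient.mk V z = 0
    rw [← map_zsmul, Ideal.Quotient.eq_zero_iff_mem]
    have : (n : ℤ) • z = z * (n : LaurentPolynomial S) := by simp [mul_comm]
    rw [this]
    exact V.mul_mem_left _ (Ideal.mem_sup_right (Ideal.mem_span_singleton_self _))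
  apply D.sep_of_ideal H x y hd V
  intro h hh hV
  change c (D.L h) (D.d h) ∈ V at hV
  obtain ⟨u, hu, v, hv, huv⟩ := Submodule.mem_sup.1 hV
  obtain ⟨w, rfl⟩ := Ideal.mem_span_singleton'.1 hv
  apply hdiv _ (claim2 h hh) (claim1 h hh) (π w)
  rw [← huv, map_add, (Ideal.Quotient.eq_zero_iff_mem).2 hu, map_mul]
  simp [mul_comm]

/-- hereditary conjugacy separability -/
theorem hcs {G : Type} [Group G] (D : LampData S G) (hS : Function.Surjective (Int.cast : ℤ → S)) (hS' : ResFin S) :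
    IsHereditarilyConjSeparable G := by
  intro H hH x y hc
  by_cases hd : D.d x = D.d y
  · by_cases h0 : D.d x = 0
    · exact D.sep_zero hS' H hH x y h0 (by rw [← hd, h0]) hc
    · exact D.sep_ne hS H hH x y hd h0 hc
  · exact D.sep_of_d H x y hd

end LampData
end LampHelpers3

section LampHelpers4
open LaurentPolynomial

namespace LampData

theorem not_pcs {S : Type} [CommRing S] [Nontrivial S] {G : Type} [Group G] (D : LampData S G)
    (q : ℕ) (hq : q.Prime) : ¬ pConjSep q G := by
  intro hsep
  let k : ℤ := q + 1
  let a := D.el 1 0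
  let t := D.el 0 1
  let x := D.el 0 k
  have htpow : ∀ n : ℤ, D.L (t ^ n) = 0 := by
    intro n
    let P : Subgroup G :=
      { carrier := {g | D.L g = 0}
        one_mem' := D.L_one
        mul_mem' := by
          intro a b ha hb
          simp only [Set.mem_ofPred_eq] at *
          rw [D.L_mul, ha, hb]; simp
        inv_mem' := by
          intro a ha
          simp only [Set.mem_ofPred_eq] at *
          rw [D.L_inv, ha]; simp }
    have h1 : t ∈ P := D.L_el 0 1
    exact P.zpow_mem h1 n
  have hy : ∀ s : G, D.L s = 0 → D.L (a * s * a⁻¹ * s⁻¹ * x) = 1 - T (D.d s) := by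
    intro s hs
    rw [D.L_mul, D.L_div _ _ (D.d_conj _ _), D.L_conj, hs, D.L_el, D.L_el]
    simp
  have hyd : ∀ s : G, D.d (a * s * a⁻¹ * s⁻¹ * x) = k := by
    intro s
    rw [D.d_mul, D.d_div, D.d_conj, D.d_el]; simp
  have hnc : ¬ IsConj x (a * t * a⁻¹ * t⁻¹ * x) := by
    intro h
    obtain ⟨c, hc⟩ := isConj_iff.1 h
    have h1 := congrArg D.L hc
    rw [hy t (D.L_el 0 1), D.L_conj, D.L_el, D.d_el, D.d_el] at h1
    have h2 := congrArg (redHom (RingHom.id S) (q + 1)) h1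
    have hk0 : ((k : ℤ) : ZMod (q + 1)) = 0 := by
      have : k = ((q + 1 : ℕ) : ℤ) := by simp [k]
      rw [this, Int.cast_natCast, ZMod.natCast_self]
    simp only [map_sub, map_mul, map_add, map_one, redHom_T, hk0, map_zero, mul_zero, add_zero]
      at h2
    rw [← AddMonoidAlgebra.one_def, sub_self, zero_mul] at h2
    have h3 := congrArg (fun e => e.coeff (0 : ZMod (q + 1))) h2
    have : Fact (1 < q + 1) := ⟨by have := hq.pos; omega⟩
    simp [AddMonoidAlgebra.one_def, Finsupp.single_apply] at h3
  obtain ⟨N, hN, hN', hsep⟩ := hsep _ _ hnc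
  obtain ⟨_, hfin, hp⟩ := hN
  apply hsep
  obtain ⟨m, hm⟩ := hp (QuotientGroup.mk t)
  have hcop : IsCoprime k ((q : ℤ) ^ m) := by
    apply IsCoprime.pow_right
    exact ⟨1, -1, by simp [k]⟩
  obtain ⟨u, v, huv⟩ := hcop
  let s := t ^ (u * k)
  have hs : (QuotientGroup.mk s : G ⧸ N) = QuotientGroup.mk t := by
    have h1 : u * k = 1 - v * ((q : ℤ) ^ m) := by linear_combination huv
    have h2 : (QuotientGroup.mk s : G ⧸ N) = (QuotientGroup.mk t) ^ (u * k) := rfl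
    have h3 : (QuotientGroup.mk t : G ⧸ N) ^ ((q : ℤ) ^ m) = 1 := by
      have : ((q : ℤ) ^ m) = ((q ^ m : ℕ) : ℤ) := by push_cast; rfl
      rw [this, zpow_natCast, hm]
    rw [h2, h1, zpow_sub, zpow_one, mul_comm v, zpow_mul, h3]; simp
  have hds : D.d s = u * k := by
    simp only [s]
    rw [D.d_zpow, D.d_el]; ring
  have hconj : IsConj x (a * s * a⁻¹ * s⁻¹ * x) := by
    have h1 : k ∈ per (Ideal.span {(1 - T k : LaurentPolynomial S)}) := by
      have h : (T k - 1 : LaurentPolynomial S) = -(1 - T k) := by ring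
      rw [mem_per, h]
      exact neg_mem (Ideal.mem_span_singleton_self _)
    have h2 := zsmul_mem h1 u
    rw [mem_per] at h2
    obtain ⟨e, he⟩ := Ideal.mem_span_singleton'.1 h2
    refine isConj_iff.2 ⟨D.el (-e) 0, ?_⟩
    apply D.ext'
    · rw [hy s (htpow _), D.L_conj, D.L_el, D.L_el, D.d_el, hds]
      rw [smul_eq_mul] at he
      linear_combination -he
    · rw [hyd, D.d_conj, D.d_el]
  have h5 : (QuotientGroup.mk (a * s * a⁻¹ * s⁻¹ * x) : G ⧸ N) = QuotientGroup.mk (a * t * a⁻¹ * t⁻¹ * x) := by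
    simp only [QuotientGroup.mk_mul, QuotientGroup.mk_inv, hs]
  rw [← h5]
  exact MonoidHom.map_isConj (QuotientGroup.mk' N) hconj

/-- coordinates on the wreath product -/
noncomputable def wreath (S : Type) [CommRing S] :
    LampData S (RWreath (Multiplicative S) (Multiplicative ℤ)) where
  L x := .ofCoeff (Finsupp.ofSupportFinite
    (fun i : ℤ => Multiplicative.toAdd ((x.left : Multiplicative ℤ → Multiplicative S)
      (Multiplicative.ofAdd i))) x.left.2)
  d x := Multiplicative.toAdd x.right
  el r i := ⟨⟨fun j => Multiplicative.ofAdd (r.coeff (Multiplicative.toAdd j)),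
    r.coeff.finite_support⟩, Multiplicative.ofAdd i⟩
  L_mul x y := by
    ext i
    have : (T (Multiplicative.toAdd x.right) : LaurentPolynomial S) =
      AddMonoidAlgebra.single (Multiplicative.toAdd x.right) 1 := rfl
    rw [this, AddMonoidAlgebra.coeff_add, Finsupp.add_apply,
      AddMonoidAlgebra.coeff_single_mul_apply, one_mul]
    rfl
  d_mul x y := rfl
  L_el r i := by ext; rfl
  d_el r i := rfl
  el_eta g := rfl

end LampData

lemma resFin_zmod (p : ℕ) [NeZero p] : ResFin (ZMod p) := by
  intro F hF
  refine ⟨ZMod p, inferInstance, inferInstance, RingHom.id _, ?_⟩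
  rintro s hs rfl
  exact hF (by simpa using hs)

lemma resFin_int : ResFin ℤ := by
  intro F hF
  refine ⟨ZMod (F.sup Int.natAbs + 1), inferInstance, inferInstance, Int.castRingHom _, ?_⟩
  intro s hs h
  rw [eq_intCast, ZMod.intCast_zmod_eq_zero_iff_dvd] at h
  have h0 : s ≠ 0 := by rintro rfl; exact hF hs
  have h1 := Nat.le_of_dvd (Int.natAbs_pos.2 h0) (Int.natCast_dvd.1 h)
  have h2 : s.natAbs ≤ F.sup Int.natAbs := Finset.le_sup hs
  omega

end LampHelpers4

/-- For every prime `p`, the lamplighter group `(ℤ/pℤ) ≀ ℤ` and the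
group `ℤ ≀ ℤ` are hereditarily conjugacy separable, but for every prime `q` neither is
`q`-hereditarily conjugacy separable. -/
theorem lamplighter_hereditarily_conjSep (p : ℕ) (hp : p.Prime) :
    IsHereditarilyConjSeparable (RWreath (Multiplicative (ZMod p)) (Multiplicative ℤ)) ∧
    IsHereditarilyConjSeparable (RWreath (Multiplicative ℤ) (Multiplicative ℤ)) ∧
    ∀ q : ℕ, q.Prime →
      ¬ pHCS q (RWreath (Multiplicative (ZMod p)) (Multiplicative ℤ)) ∧
      ¬ pHCS q (RWreath (Multiplicative ℤ) (Multiplicative ℤ)) := by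
  have : Fact p.Prime := ⟨hp⟩
  refine ⟨(LampData.wreath (ZMod p)).hcs (ZMod.intCast_surjective) (resFin_zmod p),
    (LampData.wreath ℤ).hcs (fun a => ⟨a, rfl⟩) resFin_int, fun q hq => ⟨?_, ?_⟩⟩
  · exact fun h => (LampData.wreath (ZMod p)).not_pcs q hq h.1
  · exact fun h => (LampData.wreath ℤ).not_pcs q hq h.1
end
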